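/- arXiv:2302.03966 — 4 statements merged into one kernel-verified Lean document; each statement's English description precedes it below -/
import Mathlib

section
/- For any α > 0 and integers C ≥ 2 and Δ > 1, there exist ε > 0, D₀ and n₀ such that the following holds for any D ≥ D₀ and n ≥ n₀. Let G be an n-vertex graph satisfying (1) Δ(G) ≤ CD, and (2) e(U,W) ≥ (D/(Cn))|U||W| for all sets U, W ⊆ V(G) with |U|, |W| ≥ εn. Suppose G_α is a graph on the same vertex set with minimum degree δ(G_α) ≥ αn. Then the union H := G_α ∪ G contains every tree on n vertices with maximum degree at most Δ as a subgraph. -/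
/-- `interPairs G U W` is the number of (ordered) adjacent pairs `(u, w)` with `u ∈ U`,
`w ∈ W`; for disjoint `U`, `W` this is the number of edges `e(U, W)` between `U` and `W`. -/
noncomputable def interPairs {V : Type*} (G : SimpleGraph V) (U W : Set V) : ℕ :=
  {p : V × V | p.1 ∈ U ∧ p.2 ∈ W ∧ G.Adj p.1 p.2}.ncard

open Finset Classical in
/-- Neighbourhood of a set. -/
noncomputable def nbrSet {V : Type*} [Fintype V] (G : SimpleGraph V) (X : Finset V) : Finset V :=
  univ.filter (fun y => ∃ x ∈ X, G.Adj x y)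

section FP
open Finset Classical
variable {V : Type*} [Fintype V] {G : SimpleGraph V}

theorem mem_nbrSet {X : Finset V} {y : V} : y ∈ nbrSet G X ↔ ∃ x ∈ X, G.Adj x y := by
  simp [nbrSet]

theorem nbrSet_union (X Z : Finset V) : nbrSet G (X ∪ Z) = nbrSet G X ∪ nbrSet G Z := by
  ext y; simp only [mem_nbrSet, mem_union]; aesop

theorem nbrSet_inter_sub (X Z : Finset V) : nbrSet G (X ∩ Z) ⊆ nbrSet G X ∩ nbrSet G Z := by
  intro y; simp only [mem_nbrSet, mem_inter]; aesop

/-- Friedman-Pippenger invariant. -/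
def FPInv (G : SimpleGraph V) (Y R : Finset V) (b : V → ℕ) (e : ℕ) : Prop :=
  ∀ X : Finset V, X ⊆ Y → #X ≤ 2 * e → ∑ x ∈ X, b x ≤ #(nbrSet G X ∩ R)

/-- any two sets of size `e` are joined by an edge -/
def EJoined (G : SimpleGraph V) (e : ℕ) : Prop :=
  ∀ X W : Finset V, e ≤ #X → e ≤ #W → ∃ x ∈ X, ∃ w ∈ W, G.Adj x w

theorem EJoined.large {e : ℕ} (h : EJoined G e) (he : 1 ≤ e) {X R : Finset V} (hX : e ≤ #X) :
    #R + 1 ≤ #(nbrSet G X ∩ R) + e := by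
  by_contra hcon
  push Not at hcon
  have h1 : #(R \ nbrSet G X) + #(nbrSet G X ∩ R) = #R := by
    rw [inter_comm]; exact card_sdiff_add_card_inter R (nbrSet G X)
  obtain ⟨x, hx, w, hw, hxw⟩ := h X (R \ nbrSet G X) hX (by omega)
  simp only [mem_sdiff, mem_nbrSet, not_exists, not_and] at hw
  exact hw.2 x hx hxw

theorem crit_small {e Δ : ℕ} {R X : Finset V} {b : V → ℕ} (hj : EJoined G e) (he : 1 ≤ e)
    (hb : ∀ x, b x ≤ Δ) (hroom : (2 * Δ + 1) * e ≤ #R) (hX : #X ≤ 2 * e)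
    (hc : #(nbrSet G X ∩ R) ≤ ∑ x ∈ X, b x) : #X < e := by
  by_contra hcon
  push Not at hcon
  have h1 := hj.large he (R := R) hcon
  have h2 : ∑ x ∈ X, b x ≤ #X * Δ := by
    simpa using sum_le_card_nsmul X b Δ (fun x _ => hb x)
  have h3 : #X * Δ ≤ 2 * e * Δ := Nat.mul_le_mul_right _ hX
  nlinarith

theorem crit_union {e Δ : ℕ} {Y R X Z : Finset V} {b : V → ℕ} (hj : EJoined G e) (he : 1 ≤ e)
    (hb : ∀ x, b x ≤ Δ) (hroom : (2 * Δ + 1) * e ≤ #R) (hI : FPInv G Y R b e)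
    (hXY : X ⊆ Y) (hZY : Z ⊆ Y) (hX : #X < e) (hZ : #Z < e)
    (hcX : #(nbrSet G X ∩ R) ≤ ∑ x ∈ X, b x) (hcZ : #(nbrSet G Z ∩ R) ≤ ∑ x ∈ Z, b x) :
    #(X ∪ Z) < e ∧ #(nbrSet G (X ∪ Z) ∩ R) ≤ ∑ x ∈ X ∪ Z, b x := by
  have hcard : #(X ∪ Z) ≤ 2 * e := (card_union_le X Z).trans (by omega)
  have hi := hI (X ∩ Z) (inter_subset_left.trans hXY)
    ((card_le_card inter_subset_left).trans (by omega))
  have hs : ∑ x ∈ X ∪ Z, b x + ∑ x ∈ X ∩ Z, b x = ∑ x ∈ X, b x + ∑ x ∈ Z, b x :=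
    sum_union_inter
  have hu : #(nbrSet G (X ∪ Z) ∩ R) + #(nbrSet G (X ∩ Z) ∩ R)
      ≤ #(nbrSet G X ∩ R) + #(nbrSet G Z ∩ R) := by
    rw [nbrSet_union, union_inter_distrib_right,
      ← card_union_add_card_inter (nbrSet G X ∩ R)]
    refine Nat.add_le_add_left (card_le_card ?_) _
    intro y hy
    have := nbrSet_inter_sub (G := G) X Z (mem_inter.1 hy).1
    have h2 := (mem_inter.1 hy).2
    rw [mem_inter] at this
    exact mem_inter.2 ⟨mem_inter.2 ⟨this.1, h2⟩, mem_inter.2 ⟨this.2, h2⟩⟩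
  have hc : #(nbrSet G (X ∪ Z) ∩ R) ≤ ∑ x ∈ X ∪ Z, b x := by omega
  exact ⟨crit_small hj he hb hroom hcard hc, hc⟩

theorem FPInv.remove {Y R Z : Finset V} {b b' : V → ℕ} {e : ℕ} (hI : FPInv G Y R b e)
    (hb' : ∀ x, b' x ≤ b x) {y : V} (hy : y ∉ nbrSet G Z)
    (hmax : ∀ X, X ⊆ Y → #X ≤ 2 * e → #(nbrSet G X ∩ R) ≤ ∑ x ∈ X, b x →
      ∑ x ∈ X, b x = ∑ x ∈ X, b' x → X ⊆ Z) :
    FPInv G Y (R.erase y) b' e := by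
  intro X hXY hX
  by_contra hcon
  push Not at hcon
  have h1 := hI X hXY hX
  have h2 : ∑ x ∈ X, b' x ≤ ∑ x ∈ X, b x := sum_le_sum (fun x _ => hb' x)
  have h3 : #(nbrSet G X ∩ R) ≤ #(nbrSet G X ∩ R.erase y) + 1 := by
    rw [inter_erase]; have := pred_card_le_card_erase (s := nbrSet G X ∩ R) (a := y); omega
  have h4 := hmax X hXY hX (by omega) (by omega)
  have h5 : y ∉ nbrSet G X := by
    intro h
    obtain ⟨x, hx, hxy⟩ := mem_nbrSet.1 h
    exact hy (mem_nbrSet.2 ⟨x, h4 hx, hxy⟩)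
  have h6 : nbrSet G X ∩ R.erase y = nbrSet G X ∩ R := by
    rw [inter_erase, erase_eq_of_notMem]; simp [h5]
  rw [h6] at hcon
  omega

theorem exists_max_crit {e Δ : ℕ} {Y R : Finset V} {b : V → ℕ} (hj : EJoined G e) (he : 1 ≤ e)
    (hb : ∀ x, b x ≤ Δ) (hroom : (2 * Δ + 1) * e ≤ #R) (hI : FPInv G Y R b e)
    (B : Finset V) :
    ∃ Z, Z ⊆ Y ∧ Disjoint Z B ∧ #Z < e ∧ #(nbrSet G Z ∩ R) ≤ ∑ x ∈ Z, b x ∧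
      ∀ X, X ⊆ Y → Disjoint X B → #X ≤ 2 * e → #(nbrSet G X ∩ R) ≤ ∑ x ∈ X, b x → X ⊆ Z := by
  let F : Finset (Finset V) := univ.filter (fun Z => Z ⊆ Y ∧ Disjoint Z B ∧ #Z < e ∧
    #(nbrSet G Z ∩ R) ≤ ∑ x ∈ Z, b x)
  have hF : F.Nonempty := ⟨∅, mem_filter.2 ⟨mem_univ _, by simp, by simp, by rw [card_empty]; omega, by simp [nbrSet]⟩⟩
  obtain ⟨Z, hZF, hZ⟩ := exists_max_image F card hF
  simp only [F, mem_filter, mem_univ, true_and] at hZF hZ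
  obtain ⟨h1, h2, h3, h4⟩ := hZF
  refine ⟨Z, h1, h2, h3, h4, fun X hXY hXB hX hc => ?_⟩
  have hXe := crit_small hj he hb hroom hX hc
  obtain ⟨h5, h6⟩ := crit_union hj he hb hroom hI hXY h1 hXe h3 hc h4
  have h7 := hZ (X ∪ Z) ⟨union_subset hXY h1, disjoint_union_left.2 ⟨hXB, h2⟩, h5, h6⟩
  have h8 := eq_of_subset_of_card_le subset_union_right h7
  rw [h8]; exact subset_union_left

theorem fp_step {e Δ : ℕ} {Y R : Finset V} {b : V → ℕ} (hj : EJoined G e) (he : 1 ≤ e)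
    (hb : ∀ x, b x ≤ Δ) (hroom : (2 * Δ + 1) * e ≤ #R) (hI : FPInv G Y R b e)
    {w : V} (hw : w ∈ Y) (hbw : 1 ≤ b w) :
    ∃ y ∈ R, G.Adj w y ∧ FPInv G Y (R.erase y) (Function.update b w (b w - 1)) e := by
  obtain ⟨Z, h1, h2, h3, h4, h5⟩ := exists_max_crit hj he hb hroom hI {w}
  have hwZ : w ∉ Z := by simpa using h2
  have h6 := hI (insert w Z) (insert_subset hw h1) ((card_insert_le _ _).trans (by omega))
  rw [sum_insert hwZ] at h6
  have h7 : ∃ y ∈ nbrSet G (insert w Z) ∩ R, y ∉ nbrSet G Z ∩ R :=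
    exists_mem_notMem_of_card_lt_card (by omega)
  obtain ⟨y, hy, hy'⟩ := h7
  simp only [mem_inter, mem_nbrSet, mem_insert] at hy hy'
  have hyZ : y ∉ nbrSet G Z := fun h => hy' ⟨mem_nbrSet.1 h, hy.2⟩
  obtain ⟨⟨x, hx, hxy⟩, hyR⟩ := hy
  have hxw : x = w := by
    rcases hx with rfl | hx
    · rfl
    · exact absurd (mem_nbrSet.2 ⟨x, hx, hxy⟩) hyZ
  subst hxw
  refine ⟨y, hyR, hxy, hI.remove ?_ hyZ ?_⟩
  · intro z; by_cases hz : z = x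
    · subst hz; simp
    · simp [hz]
  · intro X hXY hX hc hs
    refine h5 X hXY ?_ hX hc
    rw [disjoint_singleton_right]
    intro hxX
    have : ∑ z ∈ X, Function.update b x (b x - 1) z < ∑ z ∈ X, b z := by
      refine sum_lt_sum ?_ ⟨x, hxX, by simp; omega⟩
      intro z _; by_cases hz : z = x
      · subst hz; simp
      · simp [hz]
    omega

theorem fp_forb {e Δ : ℕ} {Y R : Finset V} {b : V → ℕ} (hj : EJoined G e) (he : 1 ≤ e)
    (hb : ∀ x, b x ≤ Δ) (hroom : (2 * Δ + 1) * e ≤ #R) (hI : FPInv G Y R b e) :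
    ∃ F : Finset V, #F ≤ Δ * e ∧ ∀ y ∈ R, y ∉ F → ∀ b' : V → ℕ, (∀ x, b' x ≤ b x) →
      FPInv G Y (R.erase y) b' e := by
  obtain ⟨Z, h1, h2, h3, h4, h5⟩ := exists_max_crit hj he hb hroom hI ∅
  refine ⟨nbrSet G Z ∩ R, ?_, ?_⟩
  · have : ∑ x ∈ Z, b x ≤ #Z * Δ := by
      simpa using sum_le_card_nsmul Z b Δ (fun x _ => hb x)
    nlinarith
  · intro y hy hyF b' hb'
    refine hI.remove hb' (fun h => hyF (mem_inter.2 ⟨h, hy⟩)) ?_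
    intro X hXY hX hc _
    exact h5 X hXY (by simp) hX hc

/-- removing a small bad set gives the initial invariant -/
theorem fp_init {e Δ : ℕ} (hj : EJoined G e) (he : 1 ≤ e) (A : Finset V)
    (hroom : (2 * Δ + 3) * e ≤ #A) :
    ∃ B : Finset V, #B < e ∧ FPInv G (univ \ B) (A \ B) (fun _ => Δ) e := by
  let F : Finset (Finset V) := univ.filter (fun Z => #Z < e ∧
    #((nbrSet G Z ∩ A) \ Z) ≤ Δ * #Z)
  have hF : F.Nonempty := ⟨∅, mem_filter.2 ⟨mem_univ _, by rw [card_empty]; omega, by simp [nbrSet]⟩⟩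
  obtain ⟨B, hBF, hB⟩ := exists_max_image F card hF
  simp only [F, mem_filter, mem_univ, true_and] at hBF hB
  obtain ⟨h1, h2⟩ := hBF
  refine ⟨B, h1, ?_⟩
  intro X hXY hX
  simp only [sum_const, smul_eq_mul]
  by_cases hXe : e ≤ #X
  · have h3 := hj.large he (R := A \ B) hXe
    have h4 := tsub_le_iff_right.1 (le_card_sdiff B A)
    have h5 : #X * Δ ≤ 2 * e * Δ := Nat.mul_le_mul_right _ hX
    nlinarith
  · push Not at hXe
    by_contra hcon
    push Not at hcon
    have hdis : Disjoint X B := by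
      rw [disjoint_left]; intro x hx hxB
      have := hXY hx; simp at this; exact this hxB
    have hXne : 0 < #X := by
      by_contra h0
      have : #X = 0 := by omega
      simp [this] at hcon
    have hcu : #(X ∪ B) = #X + #B := card_union_of_disjoint hdis
    have hle : #((nbrSet G (X ∪ B) ∩ A) \ (X ∪ B)) ≤ Δ * #(X ∪ B) := by
      have hsub : (nbrSet G (X ∪ B) ∩ A) \ (X ∪ B) ⊆
          (nbrSet G X ∩ (A \ B)) ∪ ((nbrSet G B ∩ A) \ B) := by
        intro y; rw [nbrSet_union]; simp only [mem_sdiff, mem_union, mem_inter]; tauto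
      have := (card_le_card hsub).trans (card_union_le _ _)
      rw [hcu]; nlinarith
    by_cases hue : #(X ∪ B) < e
    · have := hB (X ∪ B) ⟨hue, hle⟩
      omega
    · push Not at hue
      have h3 := hj.large he (R := A \ (X ∪ B)) hue
      have h4 := tsub_le_iff_right.1 (le_card_sdiff (X ∪ B) A)
      have h5 : nbrSet G (X ∪ B) ∩ (A \ (X ∪ B)) = (nbrSet G (X ∪ B) ∩ A) \ (X ∪ B) := by
        ext y; simp only [mem_sdiff, mem_inter]; tauto
      rw [h5] at h3
      have h6 : Δ * #(X ∪ B) ≤ Δ * (2 * e) := Nat.mul_le_mul_left _ (by omega)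
      nlinarith
end FP
section TreePart
open Finset Classical
variable {V : Type*} [Fintype V]

/-- rooted tree data -/
structure RootedAt (T : SimpleGraph V) (r : V) (par : V → V) (dep : V → ℕ) : Prop where
  dep_zero : ∀ v, dep v = 0 ↔ v = r
  adj_par : ∀ v, v ≠ r → T.Adj v (par v)
  dep_par : ∀ v, v ≠ r → dep v = dep (par v) + 1
  adj_cases : ∀ u v, T.Adj u v → (u ≠ r ∧ par u = v) ∨ (v ≠ r ∧ par v = u)

theorem exists_rooted {T : SimpleGraph V} (hT : T.IsTree) :
    ∃ r par dep, RootedAt T r par dep := by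
  have hc := hT.connected
  obtain ⟨r⟩ := hc.nonempty
  have hex : ∀ v, ∃ w, v ≠ r → T.Adj v w ∧ T.dist r v = T.dist r w + 1 := by
    intro v
    by_cases hv : v = r
    · exact ⟨r, fun h => absurd hv h⟩
    · obtain ⟨p, hp⟩ := hc.exists_walk_length_eq_dist v r
      cases p with
      | nil => exact absurd rfl hv
      | @cons _ w _ h q =>
        refine ⟨w, fun _ => ⟨h, ?_⟩⟩
        have h1 := SimpleGraph.dist_le q
        rw [SimpleGraph.Walk.length_cons] at hp
        have h2 := hT.dist_eq_dist_add_one_of_adj r h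
        rw [SimpleGraph.dist_comm (u := r) (v := v), SimpleGraph.dist_comm (u := r) (v := w)] at *
        omega
  choose par hpar using hex
  refine ⟨r, par, fun v => T.dist r v, ⟨?_, fun v hv => (hpar v hv).1, fun v hv => (hpar v hv).2, ?_⟩⟩
  · intro v; rw [hc.dist_eq_zero_iff]; exact eq_comm
  · -- counting edges
    let φ : V → Sym2 V := fun v => s(v, par v)
    have hinj : Set.InjOn φ ((univ.erase r : Finset V) : Set V) := by
      intro u hu v hv huv
      simp only [coe_erase, coe_univ, Set.mem_diff, Set.mem_univ, Set.mem_singleton_iff,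
        true_and] at hu hv
      simp only [φ, Sym2.eq_iff] at huv
      rcases huv with h | ⟨h1, h2⟩
      · exact h.1
      · have h3 := (hpar u hu).2
        have h4 := (hpar v hv).2
        rw [h2] at h3; rw [← h1] at h4; omega
    have himg : (univ.erase r).image φ ⊆ T.edgeFinset := by
      intro x hx
      obtain ⟨v, hv, rfl⟩ := mem_image.1 hx
      simp only [φ, SimpleGraph.mem_edgeFinset, SimpleGraph.mem_edgeSet]
      exact (hpar v (ne_of_mem_erase hv)).1
    have hcard : #((univ.erase r).image φ) = #T.edgeFinset := by
      rw [card_image_of_injOn hinj, card_erase_of_mem (mem_univ _), card_univ,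
        ← hT.card_edgeFinset]; omega
    have heq := eq_of_subset_of_card_le himg hcard.ge
    intro u v huv
    have : s(u, v) ∈ (univ.erase r).image φ := by
      rw [heq]; simpa using huv
    obtain ⟨w, hw, hwe⟩ := mem_image.1 this
    have hwr := ne_of_mem_erase hw
    simp only [φ, Sym2.eq_iff] at hwe
    rcases hwe with ⟨rfl, h⟩ | ⟨rfl, h⟩
    · exact Or.inl ⟨hwr, h⟩
    · exact Or.inr ⟨hwr, h⟩

/-- neighbours as a finset -/
noncomputable def nT (T : SimpleGraph V) (t : V) : Finset V := univ.filter (fun x => T.Adj t x)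

theorem mem_nT {T : SimpleGraph V} {t x : V} : x ∈ nT T t ↔ T.Adj t x := by simp [nT]

theorem exists_indep {P : Finset V} (r : V → V → Prop) (hrefl : ∀ x, r x x)
    (hsymm : ∀ x y, r x y → r y x) (K : ℕ) (hK : ∀ x ∈ P, #(P.filter (fun y => r x y)) ≤ K) :
    ∃ J ⊆ P, (∀ x ∈ J, ∀ y ∈ J, x ≠ y → ¬ r x y) ∧ #P ≤ #J * K := by
  let F : Finset (Finset V) := P.powerset.filter (fun J => ∀ x ∈ J, ∀ y ∈ J, x ≠ y → ¬ r x y)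
  have hF : F.Nonempty := ⟨∅, by simp [F]⟩
  obtain ⟨J, hJF, hJ⟩ := exists_max_image F card hF
  simp only [F, mem_filter, mem_powerset] at hJF hJ
  refine ⟨J, hJF.1, hJF.2, ?_⟩
  have hsub : P ⊆ J.biUnion (fun x => P.filter (fun y => r x y)) := by
    intro p hp
    rw [mem_biUnion]
    by_cases hpJ : p ∈ J
    · exact ⟨p, hpJ, mem_filter.2 ⟨hp, hrefl p⟩⟩
    by_contra hcon
    push Not at hcon
    have h1 : ∀ x ∈ J, ¬ r x p := fun x hx h => hcon x hx (mem_filter.2 ⟨hp, h⟩)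
    have h2 := hJ (insert p J) ⟨insert_subset hp hJF.1, by
      intro x hx y hy hxy
      rcases mem_insert.1 hx with hx1 | hx1
      · rcases mem_insert.1 hy with hy1 | hy1
        · exact absurd (hx1.trans hy1.symm) hxy
        · rw [hx1]; exact fun h => h1 y hy1 (hsymm _ _ h)
      · rcases mem_insert.1 hy with hy1 | hy1
        · rw [hy1]; exact h1 x hx1
        · exact hJF.2 x hx1 y hy1 hxy⟩
    rw [card_insert_of_notMem hpJ] at h2
    omega
  exact (card_le_card hsub).trans (card_biUnion_le_card_mul _ _ _ (fun x hx => hK x (hJF.1 hx)))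

/-- the event block of `t` -/
noncomputable def blockE (T : SimpleGraph V) (par : V → V) (t : V) : Finset V :=
  insert (par (par t)) (insert t (nT T t))

theorem mem_blockE {T : SimpleGraph V} {par : V → V} {t x : V} :
    x ∈ blockE T par t ↔ x = par (par t) ∨ x = t ∨ T.Adj t x := by
  simp [blockE, mem_nT]

/-- two blocks intersect -/
def blockConf (T : SimpleGraph V) (par : V → V) (t t' : V) : Prop :=
  ¬ Disjoint (blockE T par t) (blockE T par t')

theorem RootedAt.ne_of_dep {T : SimpleGraph V} {r : V} {par : V → V} {dep : V → ℕ}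
    (h : RootedAt T r par dep) {v : V} (hv : 1 ≤ dep v) : v ≠ r := by
  intro hvr; have := (h.dep_zero v).2 hvr; omega

theorem exists_spaced {T : SimpleGraph V} {r : V} {par : V → V} {dep : V → ℕ}
    (h : RootedAt T r par dep) {Δ : ℕ} (hΔ : ∀ v, #(nT T v) ≤ Δ) (P : Finset V) (M : ℕ)
    (hP : Δ * ((Δ + 2) * (1 + Δ + Δ * Δ) * M) + (1 + Δ + Δ * Δ) ≤ #P) (hΔ1 : 1 ≤ Δ) :
    ∃ d, 1 ≤ d ∧ d ≤ Δ ∧ ∃ J ⊆ P, #J = M ∧ (∀ t ∈ J, 3 ≤ dep t ∧ #(nT T t) = d) ∧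
      ∀ t ∈ J, ∀ t' ∈ J, t ≠ t' → Disjoint (blockE T par t) (blockE T par t') := by
  have hball : ∀ y, #(insert y (nT T y ∪ (nT T y).biUnion (nT T))) ≤ 1 + Δ + Δ * Δ := by
    intro y
    have h1 := card_insert_le y (nT T y ∪ (nT T y).biUnion (nT T))
    have h2 := card_union_le (nT T y) ((nT T y).biUnion (nT T))
    have h3 := card_biUnion_le_card_mul (nT T y) (nT T) Δ (fun x _ => hΔ x)
    have h4 := Nat.mul_le_mul_right Δ (hΔ y)
    have h5 := hΔ y
    omega
  -- vertices at grand-distance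
  have hgp : ∀ v, 2 ≤ dep v → v ∈ (nT T (par (par v))).biUnion (nT T) := by
    intro v hv
    have hv1 := h.ne_of_dep (v := v) (by omega)
    have h1 := h.dep_par v hv1
    have hv2 := h.ne_of_dep (v := par v) (by omega)
    rw [mem_biUnion]
    exact ⟨par v, mem_nT.2 (h.adj_par _ hv2).symm, mem_nT.2 (h.adj_par _ hv1).symm⟩
  let P1 := P.filter (fun v => 3 ≤ dep v)
  have hP1 : Δ * ((Δ + 2) * (1 + Δ + Δ * Δ) * M) ≤ #P1 := by
    have hs : P.filter (fun v => ¬ 3 ≤ dep v) ⊆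
        insert r (nT T r ∪ (nT T r).biUnion (nT T)) := by
      intro v hv
      have hv := (mem_filter.1 hv).2
      rw [mem_insert, mem_union]
      by_cases h0 : dep v = 0
      · exact Or.inl ((h.dep_zero v).1 h0)
      have hvr := h.ne_of_dep (v := v) (by omega)
      have hd := h.dep_par v hvr
      by_cases h1 : dep v = 1
      · have : par v = r := (h.dep_zero _).1 (by omega)
        right; left; rw [← this]; exact mem_nT.2 (h.adj_par _ hvr).symm
      · have hd2 := h.dep_par (par v) (h.ne_of_dep (by omega))
        have : par (par v) = r := (h.dep_zero _).1 (by omega)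
        right; right; rw [← this]; exact hgp v (by omega)
    have h1 := (card_le_card hs).trans (hball r)
    have h2 := card_filter_add_card_filter_not (s := P) (fun v => 3 ≤ dep v)
    simp only [P1]
    omega
  have hmaps : ∀ a ∈ P1, #(nT T a) ∈ Icc 1 Δ := by
    intro a ha
    have ha := (mem_filter.1 ha).2
    refine mem_Icc.2 ⟨?_, hΔ a⟩
    exact card_pos.2 ⟨par a, mem_nT.2 (h.adj_par a (h.ne_of_dep (by omega)))⟩
  obtain ⟨d, hd, hcard⟩ := exists_le_card_fiber_of_mul_le_card_of_maps_to hmaps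
    (n := (Δ + 2) * (1 + Δ + Δ * Δ) * M) ⟨1, by simp; omega⟩ (by simpa using hP1)
  rw [mem_Icc] at hd
  obtain ⟨J0, hJ0, hdis, hJc⟩ := exists_indep (P := P1.filter (fun a => #(nT T a) = d))
    (blockConf T par)
    (by intro x; rw [blockConf]; rw [disjoint_self_iff_empty]; exact fun hx => by
          have : x ∈ blockE T par x := mem_blockE.2 (Or.inr (Or.inl rfl))
          rw [hx] at this; simp at this)
    (by intro x y hxy hyx; exact hxy hyx.symm) ((Δ + 2) * (1 + Δ + Δ * Δ)) (by
      intro x hx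
      refine le_trans (card_le_card
        (t := (blockE T par x).biUnion (fun y => insert y (nT T y ∪ (nT T y).biUnion (nT T)))) ?_) ?_
      · intro y hy
        rw [mem_filter, mem_filter, mem_filter, blockConf, not_disjoint_iff] at hy
        obtain ⟨⟨⟨_, hy3⟩, _⟩, z, hz, hz'⟩ := hy
        rw [mem_biUnion]
        refine ⟨z, hz, ?_⟩
        rw [mem_insert, mem_union]
        rcases mem_blockE.1 hz' with h1 | h1 | h1
        · right; right; rw [h1]; exact hgp y (by omega)
        · exact Or.inl h1.symm
        · right; left; exact mem_nT.2 h1.symm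
      refine (card_biUnion_le_card_mul _ _ _ (fun y _ => hball y)).trans ?_
      refine Nat.mul_le_mul_right _ ?_
      have h1 := card_insert_le (par (par x)) (insert x (nT T x))
      have h2 := card_insert_le x (nT T x)
      have h3 := hΔ x
      unfold blockE; omega)
  have hM : M ≤ #J0 := by
    have h1 := hcard.trans hJc
    rw [mul_comm] at h1
    exact Nat.le_of_mul_le_mul_right h1 (by positivity)
  obtain ⟨J, hJ, hJM⟩ := exists_subset_card_eq hM
  refine ⟨d, hd.1, hd.2, J, ?_, hJM, ?_, ?_⟩
  · intro t ht
    exact (mem_filter.1 (mem_filter.1 (hJ0 (hJ ht))).1).1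
  · intro t ht
    have h1 := mem_filter.1 (hJ0 (hJ ht))
    exact ⟨(mem_filter.1 h1.1).2, h1.2⟩
  · intro t ht t' ht' hne
    exact not_not.1 (hdis t (hJ ht) t' (hJ ht') hne)

/-- extend a parent-closed set by one vertex inside a parent-closed target -/
theorem RootedAt.exists_next {T : SimpleGraph V} {r : V} {par : V → V} {dep : V → ℕ}
    (h : RootedAt T r par dep) {S Q : Finset V} (hr : r ∈ S)
    (hQ : ∀ v ∈ Q, v ≠ r → par v ∈ Q) (hn : ¬ Q ⊆ S) :
    ∃ v ∈ Q, v ∉ S ∧ v ≠ r ∧ par v ∈ S := by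
  have hne : (Q \ S).Nonempty := by rwa [sdiff_nonempty]
  obtain ⟨v, hv, hmin⟩ := exists_min_image (Q \ S) dep hne
  rw [mem_sdiff] at hv
  have hvr : v ≠ r := fun hh => hv.2 (hh ▸ hr)
  refine ⟨v, hv.1, hv.2, hvr, ?_⟩
  by_contra hp
  have h1 := hmin (par v) (mem_sdiff.2 ⟨hQ v hv.1 hvr, hp⟩)
  have h2 := h.dep_par v hvr
  omega

theorem RootedAt.exists_closed {T : SimpleGraph V} {r : V} {par : V → V} {dep : V → ℕ}
    (h : RootedAt T r par dep) {S : Finset V} (hr : r ∈ S)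
    (hS : ∀ v ∈ S, v ≠ r → par v ∈ S) (k : ℕ) (hk : #S + k ≤ Fintype.card V) :
    ∃ Q, S ⊆ Q ∧ (∀ v ∈ Q, v ≠ r → par v ∈ Q) ∧ #Q = #S + k := by
  induction k with
  | zero => exact ⟨S, Subset.refl _, hS, rfl⟩
  | succ k ih =>
    obtain ⟨Q, hSQ, hQ, hc⟩ := ih (by omega)
    obtain ⟨v, _, hv, hvr, hp⟩ := h.exists_next (S := Q) (Q := univ) (hSQ hr) (by simp) (by
      intro hu
      have := card_le_card hu
      rw [card_univ] at this; omega)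
    refine ⟨insert v Q, hSQ.trans (subset_insert _ _), ?_, ?_⟩
    · intro x hx hxr
      rcases mem_insert.1 hx with rfl | hx
      · exact mem_insert_of_mem hp
      · exact mem_insert_of_mem (hQ x hx hxr)
    · rw [card_insert_of_notMem hv]; omega
end TreePart
section StarPart
open Finset Classical
variable {V : Type*} [Fintype V]

/-- the star `(c, L)` is good for `(u, v)` -/
def goodP (Gα : SimpleGraph V) (u v c : V) (L : Finset V) : Prop :=
  Gα.Adj v c ∧ ∀ x ∈ L, Gα.Adj u x

/-- number of good stars -/
noncomputable def cntG (Gα : SimpleGraph V) (C : Finset V) (L : V → Finset V) (p : V × V) : ℕ :=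
  #(C.filter (fun c => goodP Gα p.1 p.2 c (L c)))

theorem star_avg {G Gα : SimpleGraph V} {K q d : ℕ} {h β : ℝ} (hβ0 : 0 < β) (hh : 0 < h)
    (hdq : d ≤ q) (hdeg : ∀ c, #(nT G c) ≤ K)
    (hβ : β * (Fintype.card V * K.choose d) ≤ h * q.choose d) [Nonempty V]
    (F : Finset V)
    (hF : ∀ u v, h ≤ #((nT Gα v \ F).filter (fun c => q ≤ #(nT G c ∩ (nT Gα u \ F)))))
    (ω : V × V → ℝ) (hω : ∀ p, 0 ≤ ω p) :
    ∃ c L, c ∉ F ∧ L ⊆ nT G c ∧ Disjoint L F ∧ #L = d ∧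
      β * ∑ p, ω p ≤ ∑ p, if goodP Gα p.1 p.2 c L then ω p else 0 := by
  let S : Finset (Σ _ : V, Finset V) := (univ \ F).sigma (fun c => powersetCard d (nT G c \ F))
  have hgood : ∀ p : V × V, h * q.choose d ≤ #(S.filter (fun s => goodP Gα p.1 p.2 s.1 s.2)) := by
    intro p
    set Cg := (nT Gα p.2 \ F).filter (fun c => q ≤ #(nT G c ∩ (nT Gα p.1 \ F))) with hCg
    have hsub : Cg.sigma (fun c => powersetCard d (nT G c ∩ (nT Gα p.1 \ F))) ⊆
        S.filter (fun s => goodP Gα p.1 p.2 s.1 s.2) := by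
      rintro ⟨c, L⟩ hs
      simp only [mem_sigma, mem_powersetCard, hCg, mem_filter, mem_sdiff, mem_nT] at hs
      obtain ⟨⟨⟨h1, h2⟩, h3⟩, h4, h5⟩ := hs
      simp only [S, mem_filter, mem_sigma, mem_powersetCard, mem_sdiff, mem_univ, true_and]
      refine ⟨⟨h2, ?_, h5⟩, h1, ?_⟩
      · intro x hx
        have := h4 hx
        simp only [mem_inter, mem_sdiff] at this ⊢
        tauto
      · intro x hx
        have := h4 hx
        simp only [mem_inter, mem_sdiff, mem_nT] at this
        tauto
    have h1 := card_le_card hsub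
    rw [card_sigma] at h1
    have h2 : #Cg * q.choose d ≤ ∑ a ∈ Cg, #(powersetCard d (nT G a ∩ (nT Gα p.1 \ F))) := by
      rw [← smul_eq_mul]
      refine card_nsmul_le_sum _ _ _ ?_
      intro c hc
      rw [card_powersetCard]
      exact Nat.choose_le_choose _ (mem_filter.1 hc).2
    have h3 : ((#Cg * q.choose d : ℕ) : ℝ) ≤
        #(S.filter (fun s => goodP Gα p.1 p.2 s.1 s.2)) := by exact_mod_cast h2.trans h1
    have h4 := hF p.1 p.2
    push_cast at h3
    refine le_trans ?_ h3
    gcongr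
  have hScard : (#S : ℝ) ≤ Fintype.card V * K.choose d := by
    have : #S ≤ Fintype.card V * K.choose d := by
      rw [card_sigma]
      refine (sum_le_card_nsmul _ _ (K.choose d) ?_).trans ?_
      · intro c _
        rw [card_powersetCard]
        exact Nat.choose_le_choose _ ((card_le_card sdiff_subset).trans (hdeg c))
      · rw [smul_eq_mul]; gcongr; exact card_le_univ _
    exact_mod_cast this
  have hSne : S.Nonempty := by
    obtain ⟨v⟩ := ‹Nonempty V›
    have h1 := hgood (v, v)
    have h2 : 0 < h * q.choose d := by
      have := Nat.choose_pos hdq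
      positivity
    have h3 : (0 : ℝ) < #(S.filter (fun s => goodP Gα v v s.1 s.2)) := h2.trans_le h1
    have h4 : 0 < #(S.filter (fun s => goodP Gα v v s.1 s.2)) := by exact_mod_cast h3
    exact (card_pos.1 h4).mono (filter_subset _ _)
  have hsum : ∑ s ∈ S, β * ∑ p, ω p ≤
      ∑ s ∈ S, ∑ p, if goodP Gα p.1 p.2 s.1 s.2 then ω p else 0 := by
    rw [sum_comm, sum_const, nsmul_eq_mul, mul_sum, mul_sum]
    refine sum_le_sum fun p _ => ?_
    rw [← sum_filter, sum_const, nsmul_eq_mul, ← mul_assoc]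
    refine mul_le_mul_of_nonneg_right ?_ (hω p)
    refine le_trans ?_ (hgood p)
    refine le_trans ?_ hβ
    rw [mul_comm]; gcongr
  obtain ⟨s, hs, hle⟩ := exists_le_of_sum_le hSne hsum
  simp only [S, mem_sigma, mem_powersetCard, mem_sdiff, mem_univ, true_and] at hs
  refine ⟨s.1, s.2, hs.1, fun x hx => (mem_sdiff.1 (hs.2.1 hx)).1, ?_, hs.2.2, hle⟩
  rw [disjoint_left]
  exact fun x hx => (mem_sdiff.1 (hs.2.1 hx)).2

theorem stars_iter {G Gα : SimpleGraph V} {K q d Lm : ℕ} {h β : ℝ} (hβ0 : 0 < β) (hh : 0 < h)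
    (hdq : d ≤ q) (hdeg : ∀ c, #(nT G c) ≤ K)
    (hβ : β * (Fintype.card V * K.choose d) ≤ h * q.choose d) [Nonempty V]
    (hF : ∀ F : Finset V, #F ≤ Lm → ∀ u v,
      h ≤ #((nT Gα v \ F).filter (fun c => q ≤ #(nT G c ∩ (nT Gα u \ F)))))
    (hβ1 : β ≤ 1) (k : ℕ) (hk : k * (d + 1) ≤ Lm) :
    ∃ (C : Finset V) (L : V → Finset V), #C = k ∧ (∀ c ∈ C, L c ⊆ nT G c ∧ #(L c) = d) ∧
      (∀ c ∈ C, ∀ c' ∈ C, c ≠ c' → Disjoint (insert c (L c)) (insert c' (L c'))) ∧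
      ∑ p, ((1 : ℝ) / 2) ^ cntG Gα C L p ≤ (Fintype.card V : ℝ) ^ 2 * (1 - β / 2) ^ k := by
  induction k with
  | zero =>
    refine ⟨∅, fun _ => ∅, rfl, by simp, by simp, ?_⟩
    simp [cntG, Fintype.card_prod, sq]
  | succ k ih =>
    obtain ⟨C, L, hC, hL, hdis, hpot⟩ := ih (le_trans (Nat.mul_le_mul_right _ (by omega)) hk)
    set F := C.biUnion (fun c => insert c (L c)) with hFdef
    have hFc : #F ≤ Lm := by
      refine le_trans (card_biUnion_le_card_mul _ _ (d + 1) ?_) ?_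
      · intro c hc
        have h1 := card_insert_le c (L c)
        have h2 := (hL c hc).2
        omega
      · rw [hC]; exact le_trans (Nat.mul_le_mul_right _ (by omega)) hk
    obtain ⟨c, Lc, hcF, hLc, hLF, hLd, hle⟩ := star_avg hβ0 hh hdq hdeg hβ F (hF F hFc)
      (fun p => ((1 : ℝ) / 2) ^ cntG Gα C L p) (fun p => by positivity)
    have hcC : c ∉ C := fun hc => hcF (mem_biUnion.2 ⟨c, hc, mem_insert_self _ _⟩)
    have hLold : ∀ x ∈ C, Function.update L c Lc x = L x := by
      intro x hx
      rw [Function.update_of_ne]; rintro rfl; exact hcC hx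
    have hnewdis : ∀ x ∈ C, Disjoint (insert c Lc) (insert x (L x)) := by
      intro x hx
      have hsub : insert x (L x) ⊆ F := subset_biUnion_of_mem (fun c => insert c (L c)) hx
      refine Disjoint.mono_right hsub ?_
      rw [disjoint_insert_left]; exact ⟨hcF, hLF⟩
    refine ⟨insert c C, Function.update L c Lc, by rw [card_insert_of_notMem hcC, hC], ?_, ?_, ?_⟩
    · intro x hx
      rcases mem_insert.1 hx with rfl | hx
      · simp [hLc, hLd]
      · rw [hLold x hx]; exact hL x hx
    · intro x hx y hy hxy
      rcases mem_insert.1 hx with hx1 | hx1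
      · rcases mem_insert.1 hy with hy1 | hy1
        · exact absurd (hx1.trans hy1.symm) hxy
        · rw [hLold y hy1, hx1]; simpa using hnewdis y hy1
      · rcases mem_insert.1 hy with hy1 | hy1
        · rw [hLold x hx1, hy1]; simpa using (hnewdis x hx1).symm
        · rw [hLold x hx1, hLold y hy1]; exact hdis x hx1 y hy1 hxy
    · have hcnt : ∀ p, cntG Gα (insert c C) (Function.update L c Lc) p =
          cntG Gα C L p + if goodP Gα p.1 p.2 c Lc then 1 else 0 := by
        intro p
        unfold cntG
        rw [filter_insert]
        have hf : C.filter (fun x => goodP Gα p.1 p.2 x (Function.update L c Lc x)) =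
            C.filter (fun x => goodP Gα p.1 p.2 x (L x)) := by
          refine filter_congr fun x hx => ?_
          rw [hLold x hx]
        rw [hf]
        simp only [Function.update_self]
        split_ifs
        · rw [card_insert_of_notMem]
          intro hcc; exact hcC (mem_filter.1 hcc).1
        · rfl
      have hterm : ∀ p, ((1 : ℝ) / 2) ^ cntG Gα (insert c C) (Function.update L c Lc) p =
          (1 / 2) ^ cntG Gα C L p -
            (if goodP Gα p.1 p.2 c Lc then ((1 : ℝ) / 2) ^ cntG Gα C L p else 0) / 2 := by
        intro p
        rw [hcnt]
        split_ifs
        · rw [pow_succ]; ring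
        · simp
      simp_rw [hterm]
      rw [sum_sub_distrib, ← sum_div, pow_succ (1 - β / 2) k]
      have h1 : 0 ≤ 1 - β / 2 := by linarith
      have h5 := mul_le_mul_of_nonneg_right hpot h1
      beta_reduce at hle
      rw [mul_assoc, mul_sub, mul_one] at h5
      linarith

theorem stars_final {G Gα : SimpleGraph V} {K q d Lm M κ : ℕ} {h β : ℝ} (hβ0 : 0 < β) (hh : 0 < h)
    (hdq : d ≤ q) (hdeg : ∀ c, #(nT G c) ≤ K)
    (hβ : β * (Fintype.card V * K.choose d) ≤ h * q.choose d) [Nonempty V]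
    (hF : ∀ F : Finset V, #F ≤ Lm → ∀ u v,
      h ≤ #((nT Gα v \ F).filter (fun c => q ≤ #(nT G c ∩ (nT Gα u \ F)))))
    (hβ1 : β ≤ 1) (hk : M * (d + 1) ≤ Lm)
    (hκ : (Fintype.card V : ℝ) ^ 2 * (1 - β / 2) ^ M ≤ (1 / 2) ^ κ) :
    ∃ (C : Finset V) (L : V → Finset V), #C = M ∧ (∀ c ∈ C, L c ⊆ nT G c ∧ #(L c) = d) ∧
      (∀ c ∈ C, ∀ c' ∈ C, c ≠ c' → Disjoint (insert c (L c)) (insert c' (L c'))) ∧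
      ∀ u v, κ ≤ #(C.filter (fun c => goodP Gα u v c (L c))) := by
  obtain ⟨C, L, h1, h2, h3, h4⟩ := stars_iter hβ0 hh hdq hdeg hβ hF hβ1 M hk
  refine ⟨C, L, h1, h2, h3, fun u v => ?_⟩
  have h5 : ((1 : ℝ) / 2) ^ cntG Gα C L (u, v) ≤ (1 / 2) ^ κ := by
    refine le_trans ?_ (h4.trans hκ)
    exact single_le_sum (f := fun p => ((1 : ℝ) / 2) ^ cntG Gα C L p)
      (fun p _ => by positivity) (mem_univ (u, v))
  have h6 := (pow_le_pow_iff_right_of_lt_one₀ (by norm_num : (0 : ℝ) < 1 / 2) (by norm_num)).1 h5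
  exact h6
end StarPart


section EmbedPart
open Finset Classical
variable {V : Type*} [Fintype V]

/-- fixed data for the embedding -/
structure Ctx (T G Gα : SimpleGraph V) (r : V) (par : V → V) (dep : V → ℕ) (Δ e d : ℕ)
    (J C A Y : Finset V) (L : V → Finset V) : Prop where
  hR : RootedAt T r par dep
  hΔ : ∀ v, #(nT T v) ≤ Δ
  hj : EJoined G e
  he : 1 ≤ e
  hd : 1 ≤ d
  hJ : ∀ t ∈ J, 3 ≤ dep t ∧ #(nT T t) = d
  hJdis : ∀ t ∈ J, ∀ t' ∈ J, t ≠ t' → Disjoint (blockE T par t) (blockE T par t')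
  hL : ∀ c ∈ C, L c ⊆ nT G c ∧ #(L c) = d
  hCdis : ∀ c ∈ C, ∀ c' ∈ C, c ≠ c' → Disjoint (insert c (L c)) (insert c' (L c'))
  hCY : ∀ c ∈ C, insert c (L c) ⊆ Y
  hCA : ∀ c ∈ C, Disjoint (insert c (L c)) A
  hAY : A ⊆ Y

/-- partial embedding -/
structure EState (T G Gα : SimpleGraph V) (r : V) (par : V → V) (Δ e : ℕ)
    (J C A Y : Finset V) (L : V → Finset V) (S : Finset V) (f : V → V) (b : V → ℕ) : Prop where
  root : r ∈ S
  closed : ∀ v ∈ S, v ≠ r → par v ∈ S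
  inj : Set.InjOn f (S : Set V)
  hom : ∀ v ∈ S, v ≠ r → (Gα ⊔ G).Adj (f (par v)) (f v)
  block : ∀ t ∈ J, ∀ v ∈ blockE T par t, v ∈ S → blockE T par t ⊆ S
  star : ∀ t ∈ J, t ∈ S → f t ∈ C ∧ ∀ x, T.Adj t x → f x ∈ L (f t)
  other : ∀ v ∈ S, (∀ t ∈ J, v ≠ t ∧ ¬ T.Adj t v) → f v ∈ A
  bΔ : ∀ x, b x ≤ Δ
  bfree : ∀ x, x ∉ S.image f → b x = Δ
  bchild : ∀ s ∈ S, #(univ.filter (fun x => x ∉ S ∧ x ≠ r ∧ par x = s)) ≤ b (f s)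
  inv : FPInv G Y (A \ S.image f) b e

variable {T G Gα : SimpleGraph V} {r : V} {par : V → V} {dep : V → ℕ} {Δ e d : ℕ}
    {J C A Y : Finset V} {L : V → Finset V} {S : Finset V} {f : V → V} {b : V → ℕ}

theorem EState.fresh (hc : Ctx T G Gα r par dep Δ e d J C A Y L)
    (hs : EState T G Gα r par Δ e J C A Y L S f b) {c : V} (hcC : c ∈ C) (hcS : c ∉ S.image f)
    {y : V} (hy : y ∈ insert c (L c)) : y ∉ S.image f := by
  intro hyS
  obtain ⟨s, hsS, rfl⟩ := mem_image.1 hyS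
  by_cases h : ∀ t ∈ J, s ≠ t ∧ ¬ T.Adj t s
  · exact disjoint_left.1 (hc.hCA c hcC) hy (hs.other s hsS h)
  · push Not at h
    obtain ⟨t, htJ, ht⟩ := h
    have hsb : s ∈ blockE T par t := by
      rw [mem_blockE]; by_cases hst : s = t
      · exact Or.inr (Or.inl hst)
      · exact Or.inr (Or.inr (ht hst))
    have htS : t ∈ S := hs.block t htJ s hsb hsS (mem_blockE.2 (Or.inr (Or.inl rfl)))
    obtain ⟨h1, h2⟩ := hs.star t htJ htS
    have h3 : f s ∈ insert (f t) (L (f t)) := by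
      by_cases hst : s = t
      · rw [hst]; exact mem_insert_self _ _
      · exact mem_insert_of_mem (h2 s (ht hst))
    by_cases hct : c = f t
    · exact hcS (hct ▸ mem_image_of_mem f htS)
    · exact disjoint_left.1 (hc.hCdis c hcC (f t) h1 hct) hy h3

theorem EState.sub (hc : Ctx T G Gα r par dep Δ e d J C A Y L)
    (hs : EState T G Gα r par Δ e J C A Y L S f b) {s : V} (hsS : s ∈ S) : f s ∈ Y := by
  by_cases h : ∀ t ∈ J, s ≠ t ∧ ¬ T.Adj t s
  · exact hc.hAY (hs.other s hsS h)
  · push Not at h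
    obtain ⟨t, htJ, ht⟩ := h
    have hsb : s ∈ blockE T par t := by
      rw [mem_blockE]; by_cases hst : s = t
      · exact Or.inr (Or.inl hst)
      · exact Or.inr (Or.inr (ht hst))
    have htS : t ∈ S := hs.block t htJ s hsb hsS (mem_blockE.2 (Or.inr (Or.inl rfl)))
    obtain ⟨h1, h2⟩ := hs.star t htJ htS
    apply hc.hCY _ h1
    by_cases hst : s = t
    · rw [hst]; exact mem_insert_self _ _
    · exact mem_insert_of_mem (h2 s (ht hst))

theorem EState.extend (hc : Ctx T G Gα r par dep Δ e d J C A Y L)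
    (hs : EState T G Gα r par Δ e J C A Y L S f b) {N : Finset V} {v : V} {f' : V → V}
    (hSN : Disjoint S N) (hvN : v ∈ N) (hvr : v ≠ r) (hpv : par v ∈ S)
    (hN : ∀ x ∈ N, x ≠ v → x ≠ r ∧ par x ∈ N)
    (hf' : ∀ x ∈ S, f' x = f x) (hinj : Set.InjOn f' (N : Set V))
    (hav : ∀ x ∈ N, f' x ∉ S.image f)
    (hom1 : (Gα ⊔ G).Adj (f (par v)) (f' v))
    (hom2 : ∀ x ∈ N, x ≠ v → (Gα ⊔ G).Adj (f' (par x)) (f' x))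
    (hblock : ∀ t ∈ J, ∀ x ∈ N, x ∈ blockE T par t → blockE T par t ⊆ N)
    (hstar : ∀ t ∈ J, t ∈ N → f' t ∈ C ∧ ∀ x, T.Adj t x → f' x ∈ L (f' t))
    (hother : ∀ x ∈ N, (∀ t ∈ J, x ≠ t ∧ ¬ T.Adj t x) → f' x ∈ A)
    (hinv : FPInv G Y (A \ (S ∪ N).image f')
      (Function.update b (f (par v)) (b (f (par v)) - 1)) e) :
    EState T G Gα r par Δ e J C A Y L (S ∪ N) f'
      (Function.update b (f (par v)) (b (f (par v)) - 1)) := by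
  have hvS : v ∉ S := fun h => disjoint_left.1 hSN h hvN
  have himg : (S ∪ N).image f' = S.image f ∪ N.image f' := by
    rw [image_union]; congr 1
    exact image_congr (fun x hx => hf' x hx)
  refine ⟨mem_union_left _ hs.root, ?_, ?_, ?_, ?_, ?_, ?_, ?_, ?_, ?_, hinv⟩
  · intro x hx hxr
    rcases mem_union.1 hx with h | h
    · exact mem_union_left _ (hs.closed x h hxr)
    · by_cases hxv : x = v
      · rw [hxv]; exact mem_union_left _ hpv
      · exact mem_union_right _ (hN x h hxv).2
  · intro x hx y hy hxy
    have hx := mem_union.1 (mem_coe.1 hx)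
    have hy := mem_union.1 (mem_coe.1 hy)
    rcases hx with hx | hx <;> rcases hy with hy | hy
    · rw [hf' x hx, hf' y hy] at hxy; exact hs.inj hx hy hxy
    · rw [hf' x hx] at hxy
      exact absurd (mem_image_of_mem f hx) (hxy ▸ hav y hy)
    · rw [hf' y hy] at hxy
      exact absurd (mem_image_of_mem f hy) (hxy ▸ hav x hx)
    · exact hinj hx hy hxy
  · intro x hx hxr
    rcases mem_union.1 hx with h | h
    · rw [hf' x h, hf' _ (hs.closed x h hxr)]; exact hs.hom x h hxr
    · by_cases hxv : x = v
      · rw [hxv, hf' _ hpv]; exact hom1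
      · exact hom2 x h hxv
  · intro t ht x hxb hx
    rcases mem_union.1 hx with h | h
    · exact (hs.block t ht x hxb h).trans subset_union_left
    · exact (hblock t ht x h hxb).trans subset_union_right
  · intro t ht hx
    rcases mem_union.1 hx with h | h
    · rw [hf' t h]
      refine ⟨(hs.star t ht h).1, fun x hx => ?_⟩
      have hb := hs.block t ht t (mem_blockE.2 (Or.inr (Or.inl rfl))) h
      rw [hf' x (hb (mem_blockE.2 (Or.inr (Or.inr hx))))]
      exact (hs.star t ht h).2 x hx
    · exact hstar t ht h
  · intro x hx hx'
    rcases mem_union.1 hx with h | h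
    · rw [hf' x h]; exact hs.other x h hx'
    · exact hother x h hx'
  · intro x
    by_cases h : x = f (par v)
    · subst h; simp only [Function.update_self]; have := hs.bΔ (f (par v)); omega
    · rw [Function.update_of_ne h]; exact hs.bΔ x
  · intro x hx
    rw [himg, mem_union] at hx
    push Not at hx
    have h : x ≠ f (par v) := fun h => hx.1 (h ▸ mem_image_of_mem f hpv)
    rw [Function.update_of_ne h]; exact hs.bfree x hx.1
  · intro s hsS
    rcases mem_union.1 hsS with h | h
    · rw [hf' s h]
      by_cases hsv : s = par v
      · subst hsv
        rw [Function.update_self]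
        have h1 := hs.bchild (par v) h
        have h2 : #(univ.filter (fun x => x ∉ S ∪ N ∧ x ≠ r ∧ par x = par v)) <
            #(univ.filter (fun x => x ∉ S ∧ x ≠ r ∧ par x = par v)) := by
          apply card_lt_card
          rw [ssubset_iff_of_subset]
          · refine ⟨v, ?_, ?_⟩
            · simp [hvS, hvr]
            · simp [hvN]
          · intro x hx
            simp only [mem_filter, mem_univ, true_and, mem_union, not_or] at hx ⊢
            exact ⟨hx.1.1, hx.2⟩
        omega
      · have hne : f s ≠ f (par v) := fun h' => hsv (hs.inj h hpv h')
        rw [Function.update_of_ne hne]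
        refine le_trans (card_le_card ?_) (hs.bchild s h)
        intro x hx
        simp only [mem_filter, mem_univ, true_and, mem_union, not_or] at hx ⊢
        exact ⟨hx.1.1, hx.2⟩
    · have hne : f' s ≠ f (par v) := fun h' => hav s h (h' ▸ mem_image_of_mem f hpv)
      rw [Function.update_of_ne hne, hs.bfree _ (hav s h)]
      refine le_trans (card_le_card ?_) (hc.hΔ s)
      intro x hx
      simp only [mem_filter, mem_univ, true_and] at hx
      rw [mem_nT, ← hx.2.2]
      exact (hc.hR.adj_par x hx.2.1).symm

theorem EState.step_single (hc : Ctx T G Gα r par dep Δ e d J C A Y L)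
    (hs : EState T G Gα r par Δ e J C A Y L S f b)
    (hroom : (2 * Δ + 1) * e ≤ #(A \ S.image f)) {v : V}
    (hvS : v ∉ S) (hvr : v ≠ r) (hpv : par v ∈ S) (hvJ : ∀ t ∈ J, v ∉ blockE T par t) :
    ∃ f' b', EState T G Gα r par Δ e J C A Y L (S ∪ {v}) f' b' := by
  have hb1 : 1 ≤ b (f (par v)) := by
    refine le_trans ?_ (hs.bchild _ hpv)
    refine card_pos.2 ⟨v, by simp [hvS, hvr]⟩
  obtain ⟨y, hyR, hadj, hinv⟩ := fp_step hc.hj hc.he hs.bΔ hroom hs.inv (hs.sub hc hpv) hb1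
  rw [mem_sdiff] at hyR
  have hold : ∀ x ∈ S, Function.update f v y x = f x := by
    intro x hx; rw [Function.update_of_ne]; rintro rfl; exact hvS hx
  refine ⟨Function.update f v y, _, hs.extend hc (N := {v}) (v := v) ?_ (by simp) hvr hpv ?_ hold
    (by simp) ?_ ?_ ?_ ?_ ?_ ?_ ?_⟩
  · simpa using hvS
  · intro x hx hxv; exact absurd (mem_singleton.1 hx) hxv
  · intro x hx; rw [mem_singleton.1 hx, Function.update_self]; exact hyR.2
  · rw [Function.update_self]; exact Or.inr hadj
  · intro x hx hxv; exact absurd (mem_singleton.1 hx) hxv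
  · intro t ht x hx hxb; rw [mem_singleton.1 hx] at hxb; exact absurd hxb (hvJ t ht)
  · intro t ht htv
    exact absurd (mem_blockE.2 (Or.inr (Or.inl (mem_singleton.1 htv).symm))) (hvJ t ht)
  · intro x hx _; rw [mem_singleton.1 hx, Function.update_self]; exact hyR.1
  · have : A \ (S ∪ {v}).image (Function.update f v y) = (A \ S.image f).erase y := by
      rw [image_union, image_congr (g := f) (fun x hx => hold x hx)]
      ext z; simp only [mem_sdiff, mem_union, image_singleton, Function.update_self, mem_singleton,
        mem_erase]; tauto
    rw [this]; exact hinv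

theorem exists_bij_point {s t : Finset V} (hst : #s = #t) {a b : V} (ha : a ∈ s) (hb : b ∈ t) :
    ∃ φ : V → V, Set.InjOn φ (s : Set V) ∧ (∀ x ∈ s, φ x ∈ t) ∧ φ a = b := by
  let ψ := Finset.equivOfCardEq hst
  refine ⟨fun x => if h : x ∈ s then Equiv.swap ((ψ ⟨a, ha⟩ : t) : V) b ((ψ ⟨x, h⟩ : t) : V) else x,
    ?_, ?_, ?_⟩
  · intro x hx y hy hxy
    have hx : x ∈ s := hx
    have hy : y ∈ s := hy
    simp only [hx, hy, dite_true] at hxy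
    have h1 := (Equiv.injective _) hxy
    have h2 := ψ.injective (Subtype.ext h1)
    simpa using h2
  · intro x hx
    simp only [hx, dite_true]
    rw [Equiv.swap_apply_def]
    split_ifs
    · exact hb
    · exact (ψ ⟨a, ha⟩).2
    · exact (ψ ⟨x, hx⟩).2
  · simp [ha]

theorem EState.step_event (hc : Ctx T G Gα r par dep Δ e d J C A Y L)
    (hs : EState T G Gα r par Δ e J C A Y L S f b)
    (hroom : (2 * Δ + 1) * e ≤ #(A \ S.image f)) {v t : V} (htJ : t ∈ J) (hvt : v = par (par t))
    (hvS : v ∉ S) (hvr : v ≠ r) (hpv : par v ∈ S)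
    (hdeg : Δ * e + e ≤ #(nT Gα (f (par v)) ∩ (A \ S.image f)))
    (hpool : e ≤ #(C \ S.image f)) :
    ∃ f' b', EState T G Gα r par Δ e J C A Y L (S ∪ blockE T par t) f' b' := by
  obtain ⟨F, hF, hFinv⟩ := fp_forb hc.hj hc.he hs.bΔ hroom hs.inv
  have hl1 : ∀ c, ∃ l, c ∈ C → l ∈ L c := by
    intro c
    by_cases h : c ∈ C
    · have h1 := (hc.hL c h).2
      have h2 := hc.hd
      obtain ⟨l, hl⟩ := card_pos.1 (by omega : 0 < #(L c))
      exact ⟨l, fun _ => hl⟩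
    · exact ⟨c, fun h' => absurd h' h⟩
  choose l1 hl1 using hl1
  have hWcard : e ≤ #((C \ S.image f).image l1) := by
    rw [card_image_of_injOn]
    · exact hpool
    · intro x hx y hy hxy
      have hx := (mem_sdiff.1 (mem_coe.1 hx)).1
      have hy := (mem_sdiff.1 (mem_coe.1 hy)).1
      by_contra hne
      refine disjoint_left.1 (hc.hCdis x hx y hy hne) (mem_insert_of_mem (hl1 x hx)) ?_
      rw [hxy]; exact mem_insert_of_mem (hl1 y hy)
  have hScard : e ≤ #((nT Gα (f (par v)) ∩ (A \ S.image f)) \ F) := by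
    have := le_card_sdiff F (nT Gα (f (par v)) ∩ (A \ S.image f))
    omega
  obtain ⟨g, hg, l, hl, hgl⟩ := hc.hj _ _ hScard hWcard
  obtain ⟨c, hcc, rfl⟩ := mem_image.1 hl
  obtain ⟨hcC, hcS⟩ := mem_sdiff.1 hcc
  simp only [mem_sdiff, mem_inter, mem_nT] at hg
  obtain ⟨⟨hgadj, hgA, hgS⟩, hgF⟩ := hg
  -- tree facts
  have hR := hc.hR
  have htd := (hc.hJ t htJ).1
  have htr := hR.ne_of_dep (v := t) (by omega)
  have hd1 := hR.dep_par t htr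
  have hptr := hR.ne_of_dep (v := par t) (by omega)
  have hd2 := hR.dep_par (par t) hptr
  rw [← hvt] at hd2
  have hpt : par t ∈ nT T t := mem_nT.2 (hR.adj_par t htr)
  have hvnt : v ≠ t := by rintro rfl; omega
  have hnd : ∀ x ∈ nT T t, dep x + 1 = dep t ∨ dep x = dep t + 1 := by
    intro x hx
    rcases hR.adj_cases t x (mem_nT.1 hx) with h | h
    · left; rw [← h.2]; omega
    · right; rw [hR.dep_par x h.1, h.2]
  have hnv : ∀ x ∈ nT T t, x ≠ v := by
    intro x hx hxv; have := hnd x hx; rw [hxv] at this; omega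
  have hnt : ∀ x ∈ nT T t, x ≠ t := by
    intro x hx hxt; have := hnd x hx; rw [hxt] at this; omega
  have hvb : v ∈ blockE T par t := mem_blockE.2 (Or.inl hvt)
  have hSb : Disjoint S (blockE T par t) := by
    rw [disjoint_left]; intro x hx hxb
    exact hvS (hs.block t htJ x hxb hx hvb)
  obtain ⟨φ, hφi, hφm, hφp⟩ := exists_bij_point (s := nT T t) (t := L c)
    (by rw [(hc.hJ t htJ).2, (hc.hL c hcC).2]) hpt (hl1 c hcC)
  set f' : V → V := fun x => if x = v then g else if x = t then c else if x ∈ nT T t then φ x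
    else f x with hf'
  have fv : f' v = g := by simp [hf']
  have ft : f' t = c := by simp [hf', hvnt.symm]
  have fn : ∀ x ∈ nT T t, f' x = φ x := by
    intro x hx; simp [hf', hnv x hx, hnt x hx, hx]
  have fS : ∀ x ∈ S, f' x = f x := by
    intro x hx
    have hxb := disjoint_left.1 hSb hx
    rw [mem_blockE] at hxb
    push Not at hxb
    simp [hf', hvt, hxb.1, hxb.2.1, mem_nT, hxb.2.2]
  have hcases : ∀ x ∈ blockE T par t, x = v ∨ x = t ∨ x ∈ nT T t := by
    intro x hx; rw [mem_blockE] at hx; rw [mem_nT, hvt]; exact hx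
  have hfr : ∀ y ∈ insert c (L c), y ∉ S.image f := fun y hy => hs.fresh hc hcC hcS hy
  have hcLc : c ∉ L c := by
    intro h
    have := mem_nT.1 ((hc.hL c hcC).1 h)
    exact G.loopless.irrefl c this
  have hgstar : ∀ y ∈ insert c (L c), y ≠ g := by
    rintro y hy rfl; exact disjoint_left.1 (hc.hCA c hcC) hy hgA
  have hφL : ∀ x ∈ nT T t, φ x ∈ insert c (L c) := fun x hx => mem_insert_of_mem (hφm x hx)
  have hφc : ∀ x ∈ nT T t, φ x ≠ c := fun x hx h => hcLc (h ▸ hφm x hx)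
  refine ⟨f', _, hs.extend hc (N := blockE T par t) (v := v) hSb hvb hvr hpv ?_ fS
    ?_ ?_ ?_ ?_ ?_ ?_ ?_ ?_⟩
  · intro x hx hxv
    rcases hcases x hx with h | h | h
    · exact absurd h hxv
    · rw [h]; exact ⟨htr, mem_blockE.2 (Or.inr (Or.inr (mem_nT.1 hpt)))⟩
    · rcases hR.adj_cases t x (mem_nT.1 h) with h' | h'
      · rw [← h'.2]; exact ⟨hptr, mem_blockE.2 (Or.inl rfl)⟩
      · rw [h'.2]; exact ⟨h'.1, mem_blockE.2 (Or.inr (Or.inl rfl))⟩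
  · intro x hx y hy hxy
    rcases hcases x hx with h | h | h <;> rcases hcases y hy with h' | h' | h'
    · rw [h, h']
    · rw [h, h', fv, ft] at hxy; exact absurd hxy.symm (hgstar c (mem_insert_self _ _))
    · rw [h, fv, fn y h'] at hxy; exact absurd hxy.symm (hgstar _ (hφL y h'))
    · rw [h, h', fv, ft] at hxy; exact absurd hxy (hgstar c (mem_insert_self _ _))
    · rw [h, h']
    · rw [h, ft, fn y h'] at hxy; exact absurd hxy.symm (hφc y h')
    · rw [h', fv, fn x h] at hxy; exact absurd hxy (hgstar _ (hφL x h))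
    · rw [h', ft, fn x h] at hxy; exact absurd hxy (hφc x h)
    · rw [fn x h, fn y h'] at hxy; exact hφi h h' hxy
  · intro x hx
    rcases hcases x hx with h | h | h
    · rw [h, fv]; exact hgS
    · rw [h, ft]; exact hcS
    · rw [fn x h]; exact hfr _ (hφL x h)
  · rw [fv]; exact Or.inl hgadj
  · intro x hx hxv
    rcases hcases x hx with h | h | h
    · exact absurd h hxv
    · rw [h, ft, fn _ hpt]
      exact Or.inr (mem_nT.1 ((hc.hL c hcC).1 (hφm _ hpt))).symm
    · rcases hR.adj_cases t x (mem_nT.1 h) with h' | h'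
      · rw [← h'.2, ← hvt, fv, fn _ hpt, hφp]; exact Or.inr hgl
      · rw [h'.2, ft, fn x h]; exact Or.inr (mem_nT.1 ((hc.hL c hcC).1 (hφm _ h)))
  · intro t' ht' x hx hxb
    by_cases h : t = t'
    · rw [h]
    · exact absurd hxb (disjoint_left.1 (hc.hJdis t htJ t' ht' h) hx)
  · intro t' ht' ht'b
    by_cases h : t = t'
    · subst h
      rw [ft]
      refine ⟨hcC, fun x hx => ?_⟩
      rw [fn x (mem_nT.2 hx)]; exact hφm x (mem_nT.2 hx)
    · exact absurd (mem_blockE.2 (Or.inr (Or.inl rfl)))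
        (disjoint_left.1 (hc.hJdis t htJ t' ht' h) ht'b)
  · intro x hx hx'
    rcases hcases x hx with h | h | h
    · rw [h, fv]; exact hgA
    · exact absurd h (hx' t htJ).1
    · exact absurd (mem_nT.1 h) (hx' t htJ).2
  · have himg : A \ (S ∪ blockE T par t).image f' = (A \ S.image f).erase g := by
      rw [image_union, image_congr (g := f) (fun x hx => fS x hx)]
      ext z
      simp only [mem_sdiff, mem_union, mem_erase, not_or]
      constructor
      · rintro ⟨h1, h2, h3⟩
        refine ⟨?_, h1, h2⟩
        rintro rfl
        exact h3 (mem_image.2 ⟨v, hvb, fv⟩)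
      · rintro ⟨h1, h2, h3⟩
        refine ⟨h2, h3, fun h => ?_⟩
        obtain ⟨x, hx, rfl⟩ := mem_image.1 h
        rcases hcases x hx with h | h | h
        · rw [h, fv] at h1; exact h1 rfl
        · rw [h, ft] at h2
          exact disjoint_left.1 (hc.hCA c hcC) (mem_insert_self _ _) h2
        · rw [fn x h] at h2
          exact disjoint_left.1 (hc.hCA c hcC) (hφL x h) h2
    rw [himg]
    refine hFinv g (mem_sdiff.2 ⟨hgA, hgS⟩) hgF _ ?_
    intro x
    by_cases h : x = f (par v)
    · subst h; simp
    · rw [Function.update_of_ne h]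
end EmbedPart


section LoopPart
open Finset Classical
variable {V : Type*} [Fintype V]
variable {T G Gα : SimpleGraph V} {r : V} {par : V → V} {dep : V → ℕ} {Δ e d : ℕ}
    {J C A Y : Finset V} {L : V → Finset V}

theorem Ctx.root_notin (hc : Ctx T G Gα r par dep Δ e d J C A Y L) {t : V} (ht : t ∈ J) :
    r ∉ blockE T par t := by
  have hR := hc.hR
  have h3 := (hc.hJ t ht).1
  have htr := hR.ne_of_dep (v := t) (by omega)
  have hd1 := hR.dep_par t htr
  have hptr := hR.ne_of_dep (v := par t) (by omega)
  have hd2 := hR.dep_par (par t) hptr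
  have hr0 : dep r = 0 := (hR.dep_zero r).2 rfl
  rw [mem_blockE]
  rintro (h | h | h)
  · rw [← h] at hd2; omega
  · exact htr h.symm
  · rcases hR.adj_cases t r h with h' | h'
    · exact hptr h'.2
    · exact h'.1 rfl

theorem EState.start (hc : Ctx T G Gα r par dep Δ e d J C A Y L)
    (hI : FPInv G Y A (fun _ => Δ) e) (hroom : (2 * Δ + 1) * e ≤ #A) :
    ∃ f b, EState T G Gα r par Δ e J C A Y L {r} f b := by
  obtain ⟨F, hF, hFinv⟩ := fp_forb (Δ := Δ) hc.hj hc.he (fun _ => le_rfl) hroom hI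
  have he := hc.he
  have h1 : 0 < #(A \ F) := by
    have := le_card_sdiff F A
    have : (2 * Δ + 1) * e = Δ * e + Δ * e + e := by ring
    omega
  obtain ⟨y, hy⟩ := card_pos.1 h1
  rw [mem_sdiff] at hy
  refine ⟨fun _ => y, fun _ => Δ, ?_, ?_, ?_, ?_, ?_, ?_, ?_, ?_, ?_, ?_, ?_⟩
  · simp
  · intro v hv hvr; exact absurd (mem_singleton.1 hv) hvr
  · simp
  · intro v hv hvr; exact absurd (mem_singleton.1 hv) hvr
  · intro t ht v hv hvr
    rw [mem_singleton.1 hvr] at hv; exact absurd hv (hc.root_notin ht)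
  · intro t ht htr
    exact absurd (mem_blockE.2 (Or.inr (Or.inl (mem_singleton.1 htr).symm))) (hc.root_notin ht)
  · intro v _ _; exact hy.1
  · intro x; exact le_rfl
  · intro x _; rfl
  · intro s _
    refine le_trans (card_le_card ?_) (hc.hΔ s)
    intro x hx
    simp only [mem_filter, mem_univ, true_and] at hx
    rw [mem_nT, ← hx.2.2]
    exact (hc.hR.adj_par x hx.2.1).symm
  · have : A \ ({r} : Finset V).image (fun _ => y) = A.erase y := by
      ext z; simp; tauto
    rw [this]
    exact hFinv y hy.1 hy.2 _ (fun _ => le_rfl)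

theorem EState.pool (hc : Ctx T G Gα r par dep Δ e d J C A Y L) {S : Finset V} {f : V → V}
    {b : V → ℕ} (hs : EState T G Gα r par Δ e J C A Y L S f b) (hJC : #J + e ≤ #C) :
    e ≤ #(C \ S.image f) := by
  have h1 : C ∩ S.image f ⊆ J.image f := by
    intro c hcc
    obtain ⟨hcC, hcS⟩ := mem_inter.1 hcc
    obtain ⟨s, hsS, rfl⟩ := mem_image.1 hcS
    by_cases h : ∀ t ∈ J, s ≠ t ∧ ¬ T.Adj t s
    · exact absurd (hs.other s hsS h) (disjoint_left.1 (hc.hCA _ hcC) (mem_insert_self _ _))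
    · push Not at h
      obtain ⟨t, htJ, ht⟩ := h
      by_cases hst : s = t
      · exact mem_image.2 ⟨t, htJ, by rw [hst]⟩
      · have hsb : s ∈ blockE T par t := mem_blockE.2 (Or.inr (Or.inr (ht hst)))
        have htS : t ∈ S := hs.block t htJ s hsb hsS (mem_blockE.2 (Or.inr (Or.inl rfl)))
        obtain ⟨h1, h2⟩ := hs.star t htJ htS
        have h3 := h2 s (ht hst)
        have hne : f s ≠ f t := fun h => hst (hs.inj hsS htS h)
        exact absurd (mem_insert_of_mem h3)
          (disjoint_left.1 (hc.hCdis _ hcC _ h1 hne) (mem_insert_self _ _))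
  have h2 := (card_le_card h1).trans card_image_le
  have h3 := card_sdiff_add_card_inter C (S.image f)
  omega

theorem EState.loop1 (hc : Ctx T G Gα r par dep Δ e d J C A Y L) {P : Finset V}
    (hPc : ∀ v ∈ P, v ≠ r → par v ∈ P) (hPJ : ∀ t ∈ J, blockE T par t ⊆ P)
    (hroom : (2 * Δ + 1) * e + #P ≤ #A) {a : ℕ} (ha : ∀ w, a ≤ #(nT Gα w))
    (hdeg : Fintype.card V + #P + Δ * e + e ≤ a + #A) (hJC : #J + e ≤ #C) :
    ∀ (k : ℕ) (S : Finset V) (f : V → V) (b : V → ℕ), S ⊆ P → #P - #S ≤ k →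
      EState T G Gα r par Δ e J C A Y L S f b →
      ∃ f' b', EState T G Gα r par Δ e J C A Y L P f' b' := by
  have hR := hc.hR
  intro k
  induction k with
  | zero =>
    intro S f b hSP hk hs
    have : S = P := eq_of_subset_of_card_le hSP (by omega)
    subst this; exact ⟨f, b, hs⟩
  | succ k ih =>
    intro S f b hSP hk hs
    by_cases hPS : P ⊆ S
    · have : S = P := subset_antisymm hSP hPS
      subst this; exact ⟨f, b, hs⟩
    obtain ⟨v, hvP, hvS, hvr, hpv⟩ := hR.exists_next hs.root hPc hPS
    have hSc := card_le_card hSP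
    have hic : #(S.image f) ≤ #S := card_image_le
    have hA' := le_card_sdiff (S.image f) A
    have hroom' : (2 * Δ + 1) * e ≤ #(A \ S.image f) := by omega
    have key : ∀ S', S ⊆ S' → v ∈ S' → S' ⊆ P →
        (∃ f' b', EState T G Gα r par Δ e J C A Y L S' f' b') →
        ∃ f' b', EState T G Gα r par Δ e J C A Y L P f' b' := by
      rintro S' h1 h2 h3 ⟨f', b', h4⟩
      refine ih S' f' b' h3 ?_ h4
      have : #S < #S' := card_lt_card ((ssubset_iff_of_subset h1).2 ⟨v, h2, hvS⟩)
      omega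
    by_cases hv : ∀ t ∈ J, v ∉ blockE T par t
    · exact key (S ∪ {v}) subset_union_left (by simp)
        (union_subset hSP (by simpa using hvP)) (hs.step_single hc hroom' hvS hvr hpv hv)
    · push Not at hv
      obtain ⟨t, htJ, hvt⟩ := hv
      have hno : ∀ x ∈ blockE T par t, x ∉ S := fun x hx hxS => hvS (hs.block t htJ x hx hxS hvt)
      have h3 := (hc.hJ t htJ).1
      have htr := hR.ne_of_dep (v := t) (by omega)
      have hpt := hR.adj_par t htr
      have hv' : v = par (par t) := by
        rcases mem_blockE.1 hvt with h | h | h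
        · exact h
        · subst h; exact absurd hpv (hno _ (mem_blockE.2 (Or.inr (Or.inr hpt))))
        · rcases hR.adj_cases t v h with h' | h'
          · rw [← h'.2] at hpv
            exact absurd hpv (hno _ (mem_blockE.2 (Or.inl rfl)))
          · rw [h'.2] at hpv
            exact absurd hpv (hno _ (mem_blockE.2 (Or.inr (Or.inl rfl))))
      refine key (S ∪ blockE T par t) subset_union_left (mem_union_right _ hvt)
        (union_subset hSP (hPJ t htJ)) (hs.step_event hc hroom' htJ hv' hvS hvr hpv ?_
          (hs.pool hc hJC))
      have h5 := ha (f (par v))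
      have h6 := card_union_add_card_inter (nT Gα (f (par v))) (A \ S.image f)
      have h7 : #(nT Gα (f (par v)) ∪ (A \ S.image f)) ≤ Fintype.card V := card_le_univ _
      omega

theorem EState.room2 (hc : Ctx T G Gα r par dep Δ e d J C A Y L) {S : Finset V} {f : V → V}
    {b : V → ℕ} (hs : EState T G Gα r par Δ e J C A Y L S f b)
    (hJS : ∀ t ∈ J, blockE T par t ⊆ S) :
    #A + #J * (d + 1) ≤ #(A \ S.image f) + #S := by
  set U := J.biUnion (fun t => insert t (nT T t)) with hU
  have hUS : U ⊆ S := by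
    intro x hx
    obtain ⟨t, ht, hx⟩ := mem_biUnion.1 hx
    apply hJS t ht
    rw [mem_insert, mem_nT] at hx
    exact mem_blockE.2 (Or.inr hx)
  have hUc : #U = #J * (d + 1) := by
    rw [hU, card_biUnion]
    · rw [sum_const_nat (m := d + 1)]
      intro t ht
      rw [card_insert_of_notMem, (hc.hJ t ht).2]
      rw [mem_nT]; exact T.loopless.irrefl t
    · intro t ht t' ht' hne
      refine disjoint_of_subset_left ?_ (disjoint_of_subset_right ?_ (hc.hJdis t ht t' ht' hne))
      · intro x hx; rw [mem_insert, mem_nT] at hx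
        exact mem_blockE.2 (Or.inr hx)
      · intro x hx; rw [mem_insert, mem_nT] at hx
        exact mem_blockE.2 (Or.inr hx)
  have h1 : A ∩ S.image f ⊆ (S \ U).image f := by
    intro y hy
    obtain ⟨hyA, hyS⟩ := mem_inter.1 hy
    obtain ⟨s, hsS, rfl⟩ := mem_image.1 hyS
    refine mem_image_of_mem f (mem_sdiff.2 ⟨hsS, fun hsU => ?_⟩)
    obtain ⟨t, ht, hx⟩ := mem_biUnion.1 hsU
    obtain ⟨h2, h3⟩ := hs.star t ht (hJS t ht (mem_blockE.2 (Or.inr (Or.inl rfl))))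
    refine disjoint_left.1 (hc.hCA _ h2) ?_ hyA
    rw [mem_insert, mem_nT] at hx
    rcases hx with h | h
    · rw [h]; exact mem_insert_self _ _
    · exact mem_insert_of_mem (h3 s h)
  have h2 := (card_le_card h1).trans card_image_le
  have h3 := card_sdiff_add_card_inter A (S.image f)
  have h4 := card_sdiff_add_card_eq_card hUS
  omega

theorem EState.loop2 (hc : Ctx T G Gα r par dep Δ e d J C A Y L) {P : Finset V}
    (hPc : ∀ v ∈ P, v ≠ r → par v ∈ P)
    (hroom : (2 * Δ + 1) * e + #P ≤ #A + #J * (d + 1)) :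
    ∀ (k : ℕ) (S : Finset V) (f : V → V) (b : V → ℕ), S ⊆ P → (∀ t ∈ J, blockE T par t ⊆ S) →
      #P - #S ≤ k → EState T G Gα r par Δ e J C A Y L S f b →
      ∃ f' b', EState T G Gα r par Δ e J C A Y L P f' b' := by
  have hR := hc.hR
  intro k
  induction k with
  | zero =>
    intro S f b hSP hJS hk hs
    have : S = P := eq_of_subset_of_card_le hSP (by omega)
    subst this; exact ⟨f, b, hs⟩
  | succ k ih =>
    intro S f b hSP hJS hk hs
    by_cases hPS : P ⊆ S
    · have : S = P := subset_antisymm hSP hPS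
      subst this; exact ⟨f, b, hs⟩
    obtain ⟨v, hvP, hvS, hvr, hpv⟩ := hR.exists_next hs.root hPc hPS
    have hSc := card_le_card hSP
    have hrm := hs.room2 hc hJS
    obtain ⟨f', b', hs'⟩ := hs.step_single hc (by omega) hvS hvr hpv
      (fun t ht hv => hvS (hJS t ht hv))
    refine ih (S ∪ {v}) f' b' (union_subset hSP (by simpa using hvP))
      (fun t ht => (hJS t ht).trans subset_union_left) ?_ hs'
    have : #S < #(S ∪ {v}) :=
      card_lt_card ((ssubset_iff_of_subset subset_union_left).2 ⟨v, by simp, hvS⟩)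
    omega

theorem swap_loop (hR : RootedAt T r par dep) (L : V → Finset V) :
    ∀ (k : ℕ) (S : Finset V) (f : V → V) (J : Finset V),
      #S + k = Fintype.card V → r ∈ S → (∀ v ∈ S, v ≠ r → par v ∈ S) →
      Set.InjOn f (S : Set V) → (∀ v ∈ S, v ≠ r → (Gα ⊔ G).Adj (f (par v)) (f v)) →
      (∀ t ∈ J, ∀ t' ∈ J, t ≠ t' → Disjoint (blockE T par t) (blockE T par t')) →
      (∀ t ∈ J, t ∈ S ∧ ∀ x, T.Adj t x → x ∈ S ∧ f x ∈ L (f t)) →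
      (∀ u v, k ≤ #(J.filter (fun t => goodP Gα u v (f t) (L (f t))))) →
      ∃ g : V → V, Function.Injective g ∧ ∀ v, v ≠ r → (Gα ⊔ G).Adj (g (par v)) (g v) := by
  intro k
  induction k with
  | zero =>
    intro S f J hk hr hcl hinj hom _ _ _
    have hS : S = univ := (card_eq_iff_eq_univ S).1 (by omega)
    subst hS
    refine ⟨f, fun x y h => hinj (by simp) (by simp) h, fun v hv => hom v (mem_univ _) hv⟩
  | succ k ih =>
    intro S f J hk hr hcl hinj hom hdis hJ hcnt
    have hnS : ¬ (univ : Finset V) ⊆ S := by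
      intro h
      have := card_le_card h
      rw [card_univ] at this; omega
    obtain ⟨z, -, hzS, hzr, hpz⟩ := hR.exists_next (Q := univ) hr (fun _ _ _ => mem_univ _) hnS
    obtain ⟨u, hu⟩ : ∃ u, u ∉ S.image f := by
      by_contra hcon
      push Not at hcon
      have h1 : (univ : Finset V) ⊆ S.image f := fun x _ => hcon x
      have := (card_le_card h1).trans card_image_le
      rw [card_univ] at this; omega
    obtain ⟨t, ht⟩ := card_pos.1 (lt_of_lt_of_le (Nat.succ_pos k) (hcnt u (f (par z))))
    obtain ⟨htJ, hgv, hgu⟩ := mem_filter.1 ht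
    obtain ⟨htS, htn⟩ := hJ t htJ
    have hzt : z ≠ t := fun h => hzS (h ▸ htS)
    have hpzt : par z ≠ t := by
      intro h
      have := (hR.adj_par z hzr).symm
      rw [h] at this
      exact hzS (htn z this).1
    set f' : V → V := fun x => if x = z then f t else if x = t then u else f x with hf'
    have fz : f' z = f t := by simp [hf']
    have ft : f' t = u := by simp [hf', hzt.symm]
    have fo : ∀ x ∈ S, x ≠ t → f' x = f x := by
      intro x hx hxt
      have : x ≠ z := fun h => hzS (h ▸ hx)
      simp [hf', this, hxt]
    have htnt : ∀ x, T.Adj t x → x ≠ t := fun x h h' => by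
      rw [h'] at h; exact T.loopless.irrefl t h
    have hoth : ∀ t' ∈ J.erase t, t' ≠ t ∧ ∀ x, T.Adj t' x → x ≠ t := by
      intro t' ht'
      obtain ⟨h1, h2⟩ := mem_erase.1 ht'
      refine ⟨h1, ?_⟩
      rintro x hx rfl
      exact disjoint_left.1 (hdis t' h2 x htJ h1) (mem_blockE.2 (Or.inr (Or.inr hx)))
        (mem_blockE.2 (Or.inr (Or.inl rfl)))
    refine ih (insert z S) f' (J.erase t) ?_ (mem_insert_of_mem hr) ?_ ?_ ?_ ?_ ?_ ?_
    · rw [card_insert_of_notMem hzS]; omega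
    · intro v hv hvr
      rcases mem_insert.1 hv with h | h
      · rw [h]; exact mem_insert_of_mem hpz
      · exact mem_insert_of_mem (hcl v h hvr)
    · have main : ∀ x ∈ insert z S, x = z ∨ x = t ∨ (x ∈ S ∧ x ≠ t) := by
        intro x hx
        rcases mem_insert.1 hx with h | h
        · exact Or.inl h
        · by_cases h' : x = t
          · exact Or.inr (Or.inl h')
          · exact Or.inr (Or.inr ⟨h, h'⟩)
      have hne : ∀ x ∈ S, f x ≠ u := fun x hx h => hu (h ▸ mem_image_of_mem f hx)
      intro x hx y hy hxy
      rcases main x hx with h | h | h <;> rcases main y hy with h' | h' | h'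
      · rw [h, h']
      · rw [h, h', fz, ft] at hxy; exact absurd hxy (hne t htS)
      · rw [h, fz, fo y h'.1 h'.2] at hxy
        exact absurd (hinj htS h'.1 hxy).symm h'.2
      · rw [h, h', fz, ft] at hxy; exact absurd hxy.symm (hne t htS)
      · rw [h, h']
      · rw [h, ft, fo y h'.1 h'.2] at hxy
        exact absurd hxy.symm (hne y h'.1)
      · rw [h', fz, fo x h.1 h.2] at hxy
        exact absurd (hinj h.1 htS hxy) h.2
      · rw [h', ft, fo x h.1 h.2] at hxy
        exact absurd hxy (hne x h.1)
      · rw [fo x h.1 h.2, fo y h'.1 h'.2] at hxy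
        exact hinj h.1 h'.1 hxy
    · intro v hv hvr
      rcases mem_insert.1 hv with h | h
      · rw [h, fz, fo _ hpz hpzt]; exact Or.inl hgv
      · have hpS := hcl v h hvr
        by_cases hvt : v = t
        · have hadj := hR.adj_par v hvr
          rw [hvt] at hadj ⊢
          rw [ft, fo _ (hvt ▸ hpS) (htnt _ hadj)]
          exact Or.inl (hgu _ (htn _ hadj).2).symm
        · rw [fo v h hvt]
          by_cases hpt : par v = t
          · have hadj := (hR.adj_par v hvr).symm
            rw [hpt] at hadj ⊢
            rw [ft]
            exact Or.inl (hgu _ (htn _ hadj).2)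
          · rw [fo _ hpS hpt]; exact hom v h hvr
    · intro t1 h1 t2 h2
      exact hdis t1 (mem_of_mem_erase h1) t2 (mem_of_mem_erase h2)
    · intro t' ht'
      obtain ⟨h1, h2⟩ := hJ t' (mem_of_mem_erase ht')
      obtain ⟨h3, h4⟩ := hoth t' ht'
      refine ⟨mem_insert_of_mem h1, fun x hx => ⟨mem_insert_of_mem (h2 x hx).1, ?_⟩⟩
      rw [fo x (h2 x hx).1 (h4 x hx), fo t' h1 h3]; exact (h2 x hx).2
    · intro u' v'
      have h1 := hcnt u' v'
      have h2 : (J.filter (fun t => goodP Gα u' v' (f t) (L (f t)))).erase t ⊆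
          (J.erase t).filter (fun t => goodP Gα u' v' (f' t) (L (f' t))) := by
        intro t' ht'
        obtain ⟨h3, h4⟩ := mem_erase.1 ht'
        obtain ⟨h5, h6⟩ := mem_filter.1 h4
        rw [mem_filter, fo t' (hJ t' h5).1 h3]
        exact ⟨mem_erase.2 ⟨h3, h5⟩, h6⟩
      have h3 := card_le_card h2
      have h4 := pred_card_le_card_erase (s := J.filter (fun t => goodP Gα u' v' (f t) (L (f t))))
        (a := t)
      omega

end LoopPart


section MainComb
open Finset Classical
variable {V : Type*} [Fintype V]

theorem embed_main {T G Gα : SimpleGraph V} {Δ e M κ a : ℕ} (hT : T.IsTree)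
    (hΔ : ∀ v, #(nT T v) ≤ Δ) (hΔ1 : 1 ≤ Δ) (hj : EJoined G e) (he : 1 ≤ e)
    (hstars : ∀ d, 1 ≤ d → d ≤ Δ → ∃ (C : Finset V) (L : V → Finset V), #C = M ∧
      (∀ c ∈ C, L c ⊆ nT G c ∧ #(L c) = d) ∧
      (∀ c ∈ C, ∀ c' ∈ C, c ≠ c' → Disjoint (insert c (L c)) (insert c' (L c'))) ∧
      ∀ u v, κ ≤ #(C.filter (fun c => goodP Gα u v c (L c))))
    (ha : ∀ w, a ≤ #(nT Gα w)) (hM : 2 * e ≤ M) (hκ : (4 * Δ + 6) * e ≤ κ)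
    (hnum : (Δ + 1) * (Δ * ((Δ + 2) * (1 + Δ + Δ * Δ) * M) + (1 + Δ + Δ * Δ)) + M * (Δ + 1)
      + (4 * Δ + 4) * e ≤ a) :
    ∃ f : V → V, Function.Injective f ∧ ∀ u v, T.Adj u v → (Gα ⊔ G).Adj (f u) (f v) := by
  obtain ⟨r, par, dep, hR⟩ := exists_rooted hT
  set N := Fintype.card V with hN
  have haN : a ≤ N := (ha r).trans (card_le_univ _)
  set p0 := Δ * ((Δ + 2) * (1 + Δ + Δ * Δ) * M) + (1 + Δ + Δ * Δ) with hp0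
  have hp1 : 1 ≤ p0 := by rw [hp0]; omega
  have hp2 : p0 ≤ (Δ + 1) * p0 := Nat.le_mul_of_pos_left _ (by omega)
  have hr0 : dep r = 0 := (hR.dep_zero r).2 rfl
  -- the first part of the tree
  obtain ⟨P, hrP, hPc, hPcard⟩ := hR.exists_closed (S := {r}) (by simp)
    (fun v hv hvr => absurd (mem_singleton.1 hv) hvr) (p0 - 1)
    (by rw [card_singleton, ← hN]; omega)
  have hrP : r ∈ P := hrP (by simp)
  have hPcard : #P = p0 := by rw [hPcard, card_singleton]; omega
  obtain ⟨d, hd1, hdΔ, J, hJP, hJcard, hJ, hJdis⟩ := exists_spaced hR hΔ P (M - 2 * e) (by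
    rw [hPcard, hp0]
    gcongr
    omega) hΔ1
  set P' := P ∪ univ.filter (fun v => v ≠ r ∧ par v ∈ P) with hP'
  have hP'c : ∀ v ∈ P', v ≠ r → par v ∈ P' := by
    intro v hv hvr
    rcases mem_union.1 hv with h | h
    · exact mem_union_left _ (hPc v h hvr)
    · exact mem_union_left _ (mem_filter.1 h).2.2
  have hP'J : ∀ t ∈ J, blockE T par t ⊆ P' := by
    intro t ht
    have h3 := (hJ t ht).1
    have htr := hR.ne_of_dep (v := t) (by omega)
    have hdt := hR.dep_par t htr
    have hptr := hR.ne_of_dep (v := par t) (by omega)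
    have htP := hJP ht
    have hptP := hPc t htP htr
    intro x hx
    rcases mem_blockE.1 hx with h | h | h
    · rw [h]; exact mem_union_left _ (hPc _ hptP hptr)
    · rw [h]; exact mem_union_left _ htP
    · rcases hR.adj_cases t x h with h' | h'
      · rw [← h'.2]; exact mem_union_left _ hptP
      · exact mem_union_right _ (mem_filter.2 ⟨mem_univ _, h'.1, by rw [h'.2]; exact htP⟩)
  have hP'card : #P' ≤ (Δ + 1) * p0 := by
    have h1 : univ.filter (fun v => v ≠ r ∧ par v ∈ P) ⊆ P.biUnion (fun t => nT T t) := by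
      intro v hv
      obtain ⟨-, h1, h2⟩ := mem_filter.1 hv
      exact mem_biUnion.2 ⟨par v, h2, mem_nT.2 (hR.adj_par v h1).symm⟩
    have h2 := (card_le_card h1).trans (card_biUnion_le_card_mul P _ Δ (fun t _ => hΔ t))
    have h3 := card_union_le P (univ.filter (fun v => v ≠ r ∧ par v ∈ P))
    rw [← hP'] at h3
    rw [hPcard] at h2 h3
    have : (Δ + 1) * p0 = p0 * Δ + p0 := by ring
    omega
  -- the stars
  obtain ⟨C₀, L, hC₀, hL, hCdis, hgood⟩ := hstars d hd1 hdΔ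
  set A₁ : Finset V := univ \ C₀.biUnion (fun c => insert c (L c)) with hA₁
  have hMd : M * (d + 1) ≤ M * (Δ + 1) := by gcongr
  have hUcard : #(C₀.biUnion (fun c => insert c (L c))) ≤ M * (d + 1) := by
    rw [← hC₀]
    refine card_biUnion_le_card_mul _ _ _ (fun c hc => ?_)
    have := card_insert_le c (L c)
    rw [(hL c hc).2] at this; exact this
  have hA₁card : N ≤ #A₁ + M * (d + 1) := by
    have := le_card_sdiff (C₀.biUnion (fun c => insert c (L c))) univ
    rw [card_univ, ← hA₁, ← hN] at this
    omega
  have he4 : (4 * Δ + 4) * e = 4 * (Δ * e) + 4 * e := by ring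
  have he3 : (2 * Δ + 3) * e = 2 * (Δ * e) + 3 * e := by ring
  have he1 : (2 * Δ + 1) * e = 2 * (Δ * e) + e := by ring
  obtain ⟨B, hB, hinv⟩ := fp_init (Δ := Δ) hj he A₁ (by omega)
  set A := A₁ \ B with hA
  have hAcard : N ≤ #A + M * (d + 1) + e := by
    have := le_card_sdiff B A₁
    rw [← hA] at this; omega
  set C := C₀.filter (fun c => Disjoint (insert c (L c)) B) with hCdef
  have hCC₀ : C ⊆ C₀ := filter_subset _ _
  have hCcard : M ≤ #C + e := by
    have h1 := card_filter_add_card_filter_not (s := C₀) (fun c => Disjoint (insert c (L c)) B)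
    have h2 : #(C₀.filter (fun c => ¬ Disjoint (insert c (L c)) B)) ≤ #B := by
      have hch : ∀ c ∈ C₀.filter (fun c => ¬ Disjoint (insert c (L c)) B),
          ∃ x ∈ B, x ∈ insert c (L c) := by
        intro c hc
        have := (mem_filter.1 hc).2
        rw [not_disjoint_iff] at this
        obtain ⟨x, h1, h2⟩ := this
        exact ⟨x, h2, h1⟩
      choose! g hg1 hg2 using hch
      refine card_le_card_of_injOn g (fun c hc => hg1 c hc) ?_
      intro c hc c' hc' hcc
      by_contra hne
      refine disjoint_left.1 (hCdis c (mem_filter.1 hc).1 c' (mem_filter.1 hc').1 hne)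
        (hg2 c hc) ?_
      rw [hcc]; exact hg2 c' hc'
    rw [← hCdef] at h1
    omega
  have hctx : Ctx T G Gα r par dep Δ e d J C A (univ \ B) L := by
    refine ⟨hR, hΔ, hj, he, hd1, hJ, hJdis, fun c hc => hL c (hCC₀ hc),
      fun c hc c' hc' => hCdis c (hCC₀ hc) c' (hCC₀ hc'), ?_, ?_, ?_⟩
    · intro c hc x hx
      exact mem_sdiff.2 ⟨mem_univ _, disjoint_left.1 (mem_filter.1 hc).2 hx⟩
    · intro c hc
      rw [disjoint_left]
      intro x hx hxA
      exact (mem_sdiff.1 (mem_sdiff.1 hxA).1).2 (mem_biUnion.2 ⟨c, hCC₀ hc, hx⟩)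
    · intro x hx
      exact mem_sdiff.2 ⟨mem_univ _, (mem_sdiff.1 hx).2⟩
  obtain ⟨f0, b0, hs0⟩ := EState.start hctx hinv (by omega)
  obtain ⟨f1, b1, hs1⟩ := EState.loop1 hctx hP'c hP'J (by omega) ha (by omega) (by omega)
    _ {r} f0 b0 (singleton_subset_iff.2 (mem_union_left _ hrP)) le_rfl hs0
  obtain ⟨Q, hPQ, hQc, hQcard⟩ := hR.exists_closed (S := P') (mem_union_left _ hrP) hP'c
    (N - (4 * Δ + 4) * e - #P') (by omega)
  have hed : 2 * e * (d + 1) ≤ 2 * e * (Δ + 1) := by gcongr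
  have hed' : 2 * e * (Δ + 1) = 2 * (Δ * e) + 2 * e := by ring
  have hMe : (M - 2 * e) * (d + 1) + 2 * e * (d + 1) = M * (d + 1) := by
    rw [← add_mul]; congr 1; omega
  obtain ⟨f2, b2, hs2⟩ := EState.loop2 hctx hQc (by rw [hJcard]; omega)
    _ P' f1 b1 hPQ hP'J le_rfl hs1
  have hbQ : ∀ t ∈ J, blockE T par t ⊆ Q := fun t ht => (hP'J t ht).trans hPQ
  have htQ : ∀ t ∈ J, t ∈ Q := fun t ht => hbQ t ht (mem_blockE.2 (Or.inr (Or.inl rfl)))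
  obtain ⟨g, hg, hgom⟩ := swap_loop (G := G) (Gα := Gα) hR L ((4 * Δ + 4) * e) Q f2 J (by omega)
    hs2.root hs2.closed hs2.inj hs2.hom hJdis
    (fun t ht => ⟨htQ t ht, fun x hx => ⟨hbQ t ht (mem_blockE.2 (Or.inr (Or.inr hx))),
      (hs2.star t ht (htQ t ht)).2 x hx⟩⟩) (by
    intro u v
    have h1 := hgood u v
    have hJi : #(J.image f2) = #J := card_image_of_injOn
      (fun x hx y hy h => hs2.inj (htQ x hx) (htQ y hy) h)
    have hJsub : J.image f2 ⊆ C₀ := by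
      intro y hy
      obtain ⟨t, ht, rfl⟩ := mem_image.1 hy
      exact hCC₀ (hs2.star t ht (htQ t ht)).1
    have h2 : C₀.filter (fun c => goodP Gα u v c (L c)) ⊆ (C₀ \ J.image f2) ∪
        (J.filter (fun t => goodP Gα u v (f2 t) (L (f2 t)))).image f2 := by
      intro c hc
      obtain ⟨h3, h4⟩ := mem_filter.1 hc
      by_cases h5 : c ∈ J.image f2
      · obtain ⟨t, ht, rfl⟩ := mem_image.1 h5
        exact mem_union_right _ (mem_image_of_mem _ (mem_filter.2 ⟨ht, h4⟩))
      · exact mem_union_left _ (mem_sdiff.2 ⟨h3, h5⟩)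
    have h3 := (card_le_card h2).trans (card_union_le _ _)
    have h4 := card_sdiff_add_card_eq_card hJsub
    have h5 : #((J.filter (fun t => goodP Gα u v (f2 t) (L (f2 t)))).image f2) ≤ _ :=
      card_image_le
    have he6 : (4 * Δ + 6) * e = 4 * (Δ * e) + 6 * e := by ring
    omega)
  refine ⟨g, hg, fun u v huv => ?_⟩
  rcases hR.adj_cases u v huv with h | h
  · rw [← h.2]; exact (hgom u h.1).symm
  · rw [← h.2]; exact hgom v h.1

end MainComb


section NumPart

theorem num_lemma (α β : ℝ) (hα : 0 < α) (hβ : 0 < β) (hβ1 : β ≤ 1) (Δ : ℕ) :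
    ∃ ε : ℝ, 0 < ε ∧ ε ≤ α / 4 ∧ ∃ n₀ : ℕ, ∀ n : ℕ, n₀ ≤ n → 1 ≤ n ∧ ∃ e M κ : ℕ,
      1 ≤ e ∧ ε * n ≤ e ∧ (4 * Δ + 6) * e ≤ κ ∧ 2 * e ≤ M ∧
      (Δ + 1) * (Δ * ((Δ + 2) * (1 + Δ + Δ * Δ) * M) + (1 + Δ + Δ * Δ)) + M * (Δ + 1)
        + (4 * Δ + 4) * e ≤ ⌊α * n⌋₊ ∧ ((M * (Δ + 1) : ℕ) : ℝ) ≤ α * n / 2 ∧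
      (n : ℝ) ^ 2 * (1 - β / 2) ^ M ≤ (1 / 2) ^ κ := by
  obtain ⟨m, hm⟩ := exists_pow_lt_of_lt_one (show (0 : ℝ) < 1 / 4 by norm_num)
    (show 1 - β / 2 < 1 by linarith)
  have hm1 : 1 ≤ m := by
    rcases Nat.eq_zero_or_pos m with h | h
    · rw [h] at hm; norm_num at hm
    · exact h
  have hmR : (1 : ℝ) ≤ m := by exact_mod_cast hm1
  set c1 : ℝ := (Δ + 1) * (Δ * ((Δ + 2) * (1 + Δ + Δ * Δ))) + (Δ + 1) with hc1
  set c2 : ℝ := (Δ + 1) * (1 + Δ + Δ * Δ) with hc2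
  have hΔ0 : (0 : ℝ) ≤ Δ := Nat.cast_nonneg _
  have hc1Δ : (Δ : ℝ) + 1 ≤ c1 := by rw [hc1]; have : (0 : ℝ) ≤ (Δ + 1) * (Δ * ((Δ + 2) * (1 + Δ + Δ * Δ))) := by positivity
                                     linarith
  have hc1p : 0 < c1 := by linarith
  have hc2p : 0 < c2 := by positivity
  set γ : ℝ := α / (4 * c1) with hγ
  have hγp : 0 < γ := by positivity
  have hγc : c1 * γ = α / 4 := by rw [hγ]; field_simp
  set θ : ℝ := γ / (2 * m) with hθ
  have hθp : 0 < θ := by positivity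
  have hθm : θ * m = γ / 2 := by rw [hθ]; field_simp
  set ε : ℝ := min (α / (32 * (Δ + 1))) (θ / (2 * (4 * Δ + 6))) with hε
  have hεp : 0 < ε := by rw [hε]; apply lt_min <;> positivity
  have hε1 : ε * (32 * (Δ + 1)) ≤ α := by
    have := min_le_left (α / (32 * (Δ + 1))) (θ / (2 * (4 * Δ + 6)))
    rw [← hε, le_div_iff₀ (by positivity)] at this; exact this
  have hε2 : ε * (2 * (4 * Δ + 6)) ≤ θ := by
    have := min_le_right (α / (32 * (Δ + 1))) (θ / (2 * (4 * Δ + 6)))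
    rw [← hε, le_div_iff₀ (by positivity)] at this; exact this
  obtain ⟨w, hw⟩ := exists_nat_gt (1 / θ)
  have hwθ : 1 ≤ w * θ := by
    rw [div_lt_iff₀ hθp] at hw; exact hw.le
  have hlim : Filter.Tendsto (fun k : ℕ => (w : ℝ) ^ 2 * ((k : ℝ) ^ 2 * (1 / 2) ^ k)) Filter.atTop
      (nhds ((w : ℝ) ^ 2 * 0)) :=
    (tendsto_pow_const_mul_const_pow_of_abs_lt_one 2 (by rw [abs_of_pos] <;> norm_num)).const_mul _
  rw [mul_zero] at hlim
  obtain ⟨κ₀, hκ₀⟩ := Filter.eventually_atTop.1 (hlim.eventually_le_const (show (0 : ℝ) < 1 by norm_num))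
  refine ⟨ε, hεp, ?_, ?_⟩
  · nlinarith
  obtain ⟨n₀, hn₀⟩ := exists_nat_gt (4 * c2 / α + 1 / ε + 2 / θ + κ₀ / θ + 1)
  refine ⟨n₀, fun n hn => ?_⟩
  have hnR : 4 * c2 / α + 1 / ε + 2 / θ + κ₀ / θ + 1 < n :=
    lt_of_lt_of_le hn₀ (by exact_mod_cast hn)
  have p1 : 0 < 4 * c2 / α := by positivity
  have p2 : 0 < 1 / ε := by positivity
  have p3 : 0 < 2 / θ := by positivity
  have p4 : 0 ≤ κ₀ / θ := by positivity
  have q1 : 4 * c2 ≤ α * n := by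
    have : 4 * c2 / α ≤ n := by linarith
    rw [div_le_iff₀ hα] at this; linarith
  have q2 : 1 ≤ ε * n := by
    have : 1 / ε ≤ n := by linarith
    rw [div_le_iff₀ hεp] at this; linarith
  have q3 : 2 ≤ θ * n := by
    have : 2 / θ ≤ n := by linarith
    rw [div_le_iff₀ hθp] at this; linarith
  have q4 : κ₀ ≤ θ * n := by
    have : κ₀ / θ ≤ n := by linarith
    rw [div_le_iff₀ hθp] at this; linarith
  have hn1 : (1 : ℝ) ≤ n := by linarith
  set e := ⌈ε * n⌉₊ with he
  set M := ⌊γ * n⌋₊ with hM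
  set κ := M / m with hκ
  have he1 : 1 ≤ e := by
    have : 0 < e := Nat.ceil_pos.2 (by linarith)
    exact this
  have hele : ε * n ≤ e := Nat.le_ceil _
  have heup : (e : ℝ) ≤ 2 * (ε * n) := by
    have := (Nat.ceil_lt_add_one (show 0 ≤ ε * n by positivity)).le
    rw [← he] at this; linarith
  have hMup : (M : ℝ) ≤ γ * n := Nat.floor_le (by positivity)
  have hMlow : γ * n ≤ M + 1 := (Nat.lt_floor_add_one _).le
  have hκlow : θ * n ≤ κ := by
    have h1 : M < m * (κ + 1) := by
      rw [hκ]; exact Nat.lt_mul_div_succ M hm1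
    have h2 : (M : ℝ) + 1 ≤ m * (κ + 1) := by exact_mod_cast h1
    have h3 : γ * n = 2 * (θ * n) * m := by
      have : 2 * (θ * n) * m = 2 * (θ * m) * n := by ring
      rw [this, hθm]; ring
    have h4 : 2 * (θ * n) * m ≤ (κ + 1) * m := by rw [← h3]; linarith
    have h5 := le_of_mul_le_mul_right h4 (by linarith)
    linarith
  have hκe : (4 * Δ + 6) * e ≤ κ := by
    have : ((4 * Δ + 6 : ℝ)) * e ≤ κ := by
      calc (4 * Δ + 6 : ℝ) * e ≤ (4 * Δ + 6) * (2 * (ε * n)) := by gcongr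
        _ = ε * (2 * (4 * Δ + 6)) * n := by ring
        _ ≤ θ * n := by gcongr
        _ ≤ κ := hκlow
    exact_mod_cast this
  have hκM : κ ≤ M := Nat.div_le_self _ _
  have hc1M : c1 * M ≤ α * n / 4 := by
    calc c1 * M ≤ c1 * (γ * n) := by gcongr
      _ = c1 * γ * n := by ring
      _ = α * n / 4 := by rw [hγc]; ring
  refine ⟨by exact_mod_cast hn1, e, M, κ, he1, hele, hκe, ?_, ?_, ?_, ?_⟩
  · have : 2 * e ≤ (4 * Δ + 6) * e := Nat.mul_le_mul_right _ (by omega)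
    omega
  · apply Nat.le_floor
    push_cast
    have h1 : (4 * Δ + 4 : ℝ) * e ≤ α * n / 4 := by
      calc (4 * Δ + 4 : ℝ) * e ≤ (4 * Δ + 4) * (2 * (ε * n)) := by gcongr
        _ = ε * (32 * (Δ + 1)) * n / 4 := by ring
        _ ≤ α * n / 4 := by gcongr
    have h2 : ((Δ : ℝ) + 1) * (Δ * ((Δ + 2) * (1 + Δ + Δ * Δ) * M) + (1 + Δ + Δ * Δ)) + M * (Δ + 1)
        = c1 * M + c2 := by rw [hc1, hc2]; ring
    rw [h2]
    have : 0 < α * n := by positivity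
    linarith
  · push_cast
    have : (M : ℝ) * (Δ + 1) ≤ c1 * M := by
      rw [mul_comm c1]; gcongr
    have : 0 < α * n := by positivity
    linarith
  · have r0 : (0 : ℝ) ≤ 1 - β / 2 := by linarith
    have r1 : 1 - β / 2 ≤ 1 := by linarith
    have h1 : (1 - β / 2) ^ M ≤ (1 / 2) ^ κ * (1 / 2 : ℝ) ^ κ := by
      calc (1 - β / 2) ^ M ≤ (1 - β / 2) ^ (m * κ) :=
            pow_le_pow_of_le_one r0 r1 (Nat.mul_div_le M m)
        _ = ((1 - β / 2) ^ m) ^ κ := pow_mul _ _ _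
        _ ≤ (1 / 4 : ℝ) ^ κ := by gcongr
        _ = (1 / 2) ^ κ * (1 / 2 : ℝ) ^ κ := by rw [← mul_pow]; norm_num
    have h2 : κ₀ ≤ κ := by
      have : (κ₀ : ℝ) ≤ κ := q4.trans hκlow
      exact_mod_cast this
    have h3 := hκ₀ κ h2
    have h4 : (n : ℝ) ≤ w * κ := by
      calc (n : ℝ) = 1 * n := by ring
        _ ≤ (w * θ) * n := by gcongr
        _ = w * (θ * n) := by ring
        _ ≤ w * κ := by gcongr
    have h5 : (n : ℝ) ^ 2 * (1 / 2) ^ κ ≤ 1 := by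
      calc (n : ℝ) ^ 2 * (1 / 2) ^ κ ≤ (w * κ) ^ 2 * (1 / 2) ^ κ := by gcongr
        _ = (w : ℝ) ^ 2 * ((κ : ℝ) ^ 2 * (1 / 2) ^ κ) := by ring
        _ ≤ 1 := h3
    calc (n : ℝ) ^ 2 * (1 - β / 2) ^ M ≤ (n : ℝ) ^ 2 * ((1 / 2) ^ κ * (1 / 2 : ℝ) ^ κ) := by gcongr
      _ = (n : ℝ) ^ 2 * (1 / 2) ^ κ * (1 / 2) ^ κ := by ring
      _ ≤ 1 * (1 / 2) ^ κ := by gcongr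
      _ = (1 / 2) ^ κ := one_mul _

/-- comparison of the binomial coefficients -/
theorem choose_cmp {K q d Δ : ℕ} {η D c : ℝ} (hη : 0 < η) (hD : 0 < D) (hc : 0 < c)
    (hηc : η / (2 * c) ≤ 1) (hdΔ : d ≤ Δ) (hK : (K : ℝ) ≤ c * D) (hq : η * D ≤ q + 1)
    (hΔD : 2 * Δ ≤ η * D) (hdq : d ≤ q) :
    (η / (2 * c)) ^ Δ * K.choose d ≤ q.choose d := by
  have h1 : (K.choose d : ℝ) ≤ (K : ℝ) ^ d / d.factorial := Nat.choose_le_pow_div d K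
  have h2 : ((q + 1 - d : ℕ) : ℝ) ^ d / d.factorial ≤ q.choose d := Nat.pow_le_choose d q
  have hdR : (d : ℝ) ≤ Δ := by exact_mod_cast hdΔ
  have h3 : η * D / 2 ≤ ((q + 1 - d : ℕ) : ℝ) := by
    rw [Nat.cast_sub (by omega)]; push_cast; linarith
  calc (η / (2 * c)) ^ Δ * K.choose d ≤ (η / (2 * c)) ^ d * ((c * D) ^ d / d.factorial) := by
        apply mul_le_mul _ _ (by positivity) (by positivity)
        · exact pow_le_pow_of_le_one (by positivity) hηc hdΔ
        · refine h1.trans ?_; gcongr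
    _ = (η * D / 2) ^ d / d.factorial := by
        rw [← mul_div_assoc, ← mul_pow]; congr 2; field_simp
    _ ≤ ((q + 1 - d : ℕ) : ℝ) ^ d / d.factorial := by gcongr
    _ ≤ q.choose d := h2
end NumPart

section FinalPart
open Finset Classical

theorem ncard_nbr {V : Type*} [Fintype V] (G : SimpleGraph V) (v : V) :
    (G.neighborSet v).ncard = #(nT G v) := by
  have : G.neighborSet v = (nT G v : Set V) := by
    ext x; simp [mem_nT]
  rw [this, Set.ncard_coe_finset]

theorem interPairs_le {V : Type*} [Fintype V] (G : SimpleGraph V) (X W : Finset V) (q : ℕ)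
    (h : ∀ c ∈ X, #(nT G c ∩ W) ≤ q) : interPairs G ↑X ↑W ≤ #X * q := by
  have h1 : {p : V × V | p.1 ∈ (X : Set V) ∧ p.2 ∈ (W : Set V) ∧ G.Adj p.1 p.2} =
      ((X.biUnion (fun c => (nT G c ∩ W).image (Prod.mk c)) : Finset (V × V)) : Set (V × V)) := by
    ext ⟨x, y⟩
    simp only [Set.mem_ofPred_eq, mem_coe, mem_biUnion, mem_image, mem_inter, mem_nT, Prod.mk.injEq]
    constructor
    · rintro ⟨a, b, c⟩; exact ⟨x, a, y, ⟨c, b⟩, rfl, rfl⟩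
    · rintro ⟨x', a, y', ⟨c, b⟩, rfl, rfl⟩; exact ⟨a, b, c⟩
  unfold interPairs
  rw [h1, Set.ncard_coe_finset]
  exact card_biUnion_le_card_mul _ _ _ (fun c hc => card_image_le.trans (h c hc))

theorem star_hyp {V : Type*} [Fintype V] {G Gα : SimpleGraph V} {α ε η C D n : ℝ} {q : ℕ}
    (hα : 0 < α) (hCp : 0 < C) (hDp : 0 < D) (hnR : 1 ≤ n) (hε : 0 < ε) (hεα : ε ≤ α / 4)
    (hη : η = α / (4 * C)) (hqle : (q : ℝ) ≤ η * D)
    (hGe : ∀ U W : Finset V, ε * n ≤ (U.card : ℝ) → ε * n ≤ (W.card : ℝ) →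
      D / (C * n) * (U.card * W.card) ≤ (interPairs G ↑U ↑W : ℝ))
    (hGα : ∀ v, α * n ≤ (#(nT Gα v) : ℝ)) {F : Finset V} (hFR : (#F : ℝ) ≤ α * n / 2) (u v : V) :
    α * n / 4 ≤ #((nT Gα v \ F).filter (fun c => q ≤ #(nT G c ∩ (nT Gα u \ F)))) := by
  have hηp : 0 < η := by rw [hη]; positivity
  have hbig : ∀ w, α * n / 2 ≤ (#(nT Gα w \ F) : ℝ) := by
    intro w
    have h1 := hGα w
    have h2 : #(nT Gα w) ≤ #(nT Gα w \ F) + #F := by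
      have := le_card_sdiff F (nT Gα w); omega
    have h3 : (#(nT Gα w) : ℝ) ≤ #(nT Gα w \ F) + #F := by exact_mod_cast h2
    linarith
  set W := nT Gα u \ F with hW
  set X := (nT Gα v \ F).filter (fun c => ¬ q ≤ #(nT G c ∩ W)) with hX
  have hαn : 0 < α * n := by positivity
  have hεn : ε * n ≤ α * n / 4 := by
    calc ε * n ≤ α / 4 * n := by gcongr
      _ = α * n / 4 := by ring
  have hXsmall : (#X : ℝ) ≤ ε * n := by
    by_contra hcon
    push Not at hcon
    have h1 := hGe X W hcon.le (by have := hbig u; linarith)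
    have h2 := interPairs_le G X W q (fun c hc => by
      have := (mem_filter.1 hc).2; omega)
    have h3 : (interPairs G ↑X ↑W : ℝ) ≤ #X * q := by exact_mod_cast h2
    have hXp : (0 : ℝ) < #X := lt_of_le_of_lt (by positivity) hcon
    have h4 : (D : ℝ) / (C * n) * (#X * (α * n / 2)) ≤ #X * (η * D) := by
      calc (D : ℝ) / (C * n) * (#X * (α * n / 2)) ≤ D / (C * n) * (#X * #W) := by
            have := hbig u
            gcongr
        _ ≤ _ := h1
        _ ≤ _ := h3
        _ ≤ _ := by gcongr
    have h5 : (D : ℝ) / (C * n) * (#X * (α * n / 2)) = 2 * (#X * (η * D)) := by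
      rw [hη]; field_simp; ring
    have h6 : 0 < #X * (η * D) := by positivity
    linarith
  have h7 := card_filter_add_card_filter_not (s := nT Gα v \ F) (fun c => q ≤ #(nT G c ∩ W))
  have h8 : (#((nT Gα v \ F).filter (fun c => q ≤ #(nT G c ∩ W))) : ℝ) + #X
      = #(nT Gα v \ F) := by exact_mod_cast h7
  have := hbig v
  linarith

theorem final_le_one
    (α : ℝ) (hα : 0 < α) (hα1 : α ≤ 1) (C Δ : ℕ) (hC : 2 ≤ C) (hΔ : 1 < Δ) :
    ∃ ε : ℝ, 0 < ε ∧ ∃ D₀ n₀ : ℕ, ∀ D : ℕ, D₀ ≤ D → ∀ n : ℕ, n₀ ≤ n →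
      ∀ G Gα : SimpleGraph (Fin n),
        (∀ v, ((G.neighborSet v).ncard : ℝ) ≤ C * D) →
        (∀ U W : Finset (Fin n), ε * n ≤ (U.card : ℝ) → ε * n ≤ (W.card : ℝ) →
          (D : ℝ) / (C * n) * (U.card * W.card) ≤ (interPairs G ↑U ↑W : ℝ)) →
        (∀ v, α * n ≤ ((Gα.neighborSet v).ncard : ℝ)) →
        ∀ T : SimpleGraph (Fin n), T.IsTree →
          (∀ v, (T.neighborSet v).ncard ≤ Δ) →
          ∃ f : Fin n → Fin n, Function.Injective f ∧
            ∀ u v, T.Adj u v → (Gα ⊔ G).Adj (f u) (f v) := by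
  have hCR : (2 : ℝ) ≤ C := by exact_mod_cast hC
  have hCp : (0 : ℝ) < C := by linarith
  set η : ℝ := α / (4 * C) with hη
  have hηp : 0 < η := by positivity
  have hηc : η / (2 * C) ≤ 1 := by
    rw [div_le_one (by positivity), hη, div_le_iff₀ (by positivity)]; nlinarith
  set β : ℝ := α / 4 * (η / (2 * C)) ^ Δ with hβ
  have hβp : 0 < β := by positivity
  have hβ1 : β ≤ 1 := by
    have h1 : (η / (2 * C)) ^ Δ ≤ 1 := pow_le_one₀ (by positivity) hηc
    have h2 : 0 ≤ (η / (2 * C)) ^ Δ := by positivity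
    rw [hβ]; nlinarith
  obtain ⟨ε, hε, hεα, n₀, hn₀⟩ := num_lemma α β hα hβp hβ1 Δ
  obtain ⟨D₀, hD₀⟩ := exists_nat_gt (2 * Δ / η + 1)
  refine ⟨ε, hε, D₀, n₀, ?_⟩
  intro D hD n hn G Gα hGdeg hGe hGα T hT hTΔ
  obtain ⟨hn1, e, M, κ, he1, hele, hκe, h2M, hnum, hMα, hκ⟩ := hn₀ n hn
  have hnR : (1 : ℝ) ≤ n := by exact_mod_cast hn1
  have hDR : 2 * Δ / η + 1 < D := lt_of_lt_of_le hD₀ (by exact_mod_cast hD)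
  have hDp : (0 : ℝ) < D := by
    have : 0 ≤ 2 * Δ / η := by positivity
    linarith
  have hΔD : 2 * Δ ≤ η * D := by
    have : 2 * Δ / η ≤ D := by linarith
    rw [div_le_iff₀ hηp] at this; linarith
  simp only [ncard_nbr] at hGdeg hGα hTΔ
  have : Nonempty (Fin n) := ⟨⟨0, hn1⟩⟩
  have hj : EJoined G e := by
    intro X W hX hW
    have hX' : (e : ℝ) ≤ #X := by exact_mod_cast hX
    have hW' : (e : ℝ) ≤ #W := by exact_mod_cast hW
    have heR : (1 : ℝ) ≤ e := by exact_mod_cast he1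
    have h1 := hGe X W (by linarith) (by linarith)
    have hXp : (0 : ℝ) < #X := by linarith
    have hWp : (0 : ℝ) < #W := by linarith
    have h2 : (0 : ℝ) < D / (C * n) * (#X * #W) := by positivity
    have h3 : interPairs G ↑X ↑W ≠ 0 := by
      intro h; rw [h, Nat.cast_zero] at h1; linarith
    obtain ⟨p, hp⟩ := Set.nonempty_of_ncard_ne_zero h3
    exact ⟨p.1, hp.1, p.2, hp.2.1, hp.2.2⟩
  set q := ⌊η * D⌋₊ with hq
  have hqle : (q : ℝ) ≤ η * D := Nat.floor_le (by positivity)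
  have hqge : η * D ≤ q + 1 := (Nat.lt_floor_add_one _).le
  have hqΔ : 2 * Δ ≤ q := Nat.le_floor (by push_cast; exact hΔD)
  refine embed_main (a := ⌊α * n⌋₊) hT hTΔ hΔ.le hj he1 ?_ ?_ h2M hκe hnum
  swap
  · intro w
    have := (Nat.floor_le (show 0 ≤ α * n by positivity)).trans (hGα w)
    exact_mod_cast this
  intro d hd1 hdΔ
  have hdq : d ≤ q := by omega
  refine stars_final (K := C * D) (q := q) (Lm := M * (Δ + 1)) (h := α * n / 4) hβp (by positivity)
    hdq ?_ ?_ ?_ hβ1 ?_ ?_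
  · intro c; exact_mod_cast hGdeg c
  · have h1 := choose_cmp (K := C * D) (q := q) (d := d) (Δ := Δ) hηp hDp hCp hηc hdΔ
      (by push_cast; exact le_rfl) hqge hΔD hdq
    rw [Fintype.card_fin]
    calc β * (n * (C * D).choose d)
        = α * n / 4 * ((η / (2 * C)) ^ Δ * (C * D).choose d) := by rw [hβ]; ring
      _ ≤ α * n / 4 * q.choose d := by gcongr
  · intro F hF u v
    refine star_hyp hα hCp hDp hnR hε hεα hη hqle hGe hGα ?_ u v
    refine le_trans ?_ hMα
    exact_mod_cast hF
  · gcongr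
  · rw [Fintype.card_fin]; exact hκ
end FinalPart

/-- **Theorem 2 (Böttcher et al.).** For any `α > 0` and integers `C ≥ 2`, `Δ > 1`, there exist
`ε > 0`, `D₀` and `n₀` such that for any `D ≥ D₀` and `n ≥ n₀`: if `G` is an `n`-vertex graph
with `Δ(G) ≤ CD` and `e(U, W) ≥ (D/(Cn))|U||W|` for all `U, W` with `|U|, |W| ≥ εn`, and `Gα`
is a graph on the same vertex set with `δ(Gα) ≥ αn`, then `H := Gα ∪ G` contains every tree on
`n` vertices with maximum degree at most `Δ`. -/
theorem universality_perturbed_expander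
    (α : ℝ) (hα : 0 < α) (C Δ : ℕ) (hC : 2 ≤ C) (hΔ : 1 < Δ) :
    ∃ ε : ℝ, 0 < ε ∧ ∃ D₀ n₀ : ℕ, ∀ D : ℕ, D₀ ≤ D → ∀ n : ℕ, n₀ ≤ n →
      ∀ G Gα : SimpleGraph (Fin n),
        (∀ v, ((G.neighborSet v).ncard : ℝ) ≤ C * D) →
        (∀ U W : Finset (Fin n), ε * n ≤ (U.card : ℝ) → ε * n ≤ (W.card : ℝ) →
          (D : ℝ) / (C * n) * (U.card * W.card) ≤ (interPairs G ↑U ↑W : ℝ)) →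
        (∀ v, α * n ≤ ((Gα.neighborSet v).ncard : ℝ)) →
        ∀ T : SimpleGraph (Fin n), T.IsTree →
          (∀ v, (T.neighborSet v).ncard ≤ Δ) →
          ∃ f : Fin n → Fin n, Function.Injective f ∧
            ∀ u v, T.Adj u v → (Gα ⊔ G).Adj (f u) (f v) := by
  obtain ⟨ε, hε, D₀, n₀, h⟩ := final_le_one (min α 1) (lt_min hα one_pos) (min_le_right _ _) C Δ hC hΔ
  refine ⟨ε, hε, D₀, n₀, fun D hD n hn G Gα h1 h2 h3 T hT h4 => h D hD n hn G Gα h1 h2 ?_ T hT h4⟩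
  intro v
  refine le_trans ?_ (h3 v)
  gcongr
  exact min_le_left _ _
end

section
/- For any integers n, k > 2, every tree on n vertices either has at least n/(4k) leaves or contains a collection of at least n/(4k) pairwise vertex-disjoint bare paths each of length k. -/
/-- In a tree rooted at `r`, parents are unique. -/
lemma tlbp_parent_unique {V : Type*} {T : SimpleGraph V} (hT : T.IsTree) (r : V) {u u' w : V}
    (h : T.Adj u w) (h' : T.Adj u' w) (hd : T.dist r w = T.dist r u + 1)
    (hd' : T.dist r w = T.dist r u' + 1) : u = u' := by
  obtain ⟨p, hp⟩ := hT.connected.exists_walk_length_eq_dist r u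
  obtain ⟨q, hq⟩ := hT.connected.exists_walk_length_eq_dist r u'
  have h1 : (p.concat h).IsPath :=
    SimpleGraph.Walk.isPath_of_length_eq_dist _ (by rw [SimpleGraph.Walk.length_concat]; omega)
  have h2 : (q.concat h').IsPath :=
    SimpleGraph.Walk.isPath_of_length_eq_dist _ (by rw [SimpleGraph.Walk.length_concat]; omega)
  have h3 := (hT.existsUnique_path r w).unique h1 h2
  have h4 := congrArg SimpleGraph.Walk.penultimate h3
  simpa using h4

/-- A degree-two vertex other than the root has a child. -/
lemma tlbp_child {V : Type*} {T : SimpleGraph V} (hT : T.IsTree) (r : V) {u : V}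
    (hu : (T.neighborSet u).ncard = 2) :
    ∃ w, T.Adj u w ∧ T.dist r w = T.dist r u + 1 := by
  obtain ⟨x, y, hxy, hs⟩ := Set.ncard_eq_two.mp hu
  have hx : T.Adj u x := by
    have : x ∈ T.neighborSet u := by rw [hs]; simp
    exact this
  have hy : T.Adj u y := by
    have : y ∈ T.neighborSet u := by rw [hs]; simp
    exact this
  rcases hT.dist_eq_dist_add_one_of_adj r hx with h1 | h1
  · rcases hT.dist_eq_dist_add_one_of_adj r hy with h2 | h2
    · exact absurd (tlbp_parent_unique hT r hx.symm hy.symm h1 h2) hxy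
    · exact ⟨y, hy, h2⟩
  · exact ⟨x, hx, h1⟩

/-- The number of vertices whose degree is not two is at most `2ℓ - 2`. -/
lemma tlbp_count {V : Type*} [Fintype V] {T : SimpleGraph V} (hT : T.IsTree)
    (hV : 2 < Fintype.card V) :
    ({v : V | (T.neighborSet v).ncard ≠ 2}).ncard + 2 ≤
      2 * ({v : V | (T.neighborSet v).ncard = 1}).ncard := by
  classical
  have hdeg : ∀ v, (T.neighborSet v).ncard = T.degree v := by
    intro v
    rw [Set.ncard_eq_toFinset_card', SimpleGraph.degree, SimpleGraph.neighborFinset]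
  have : Nontrivial V := Fintype.one_lt_card_iff_nontrivial.mp (by omega)
  have hpos : ∀ v, 1 ≤ T.degree v := fun v => hT.connected.preconnected.degree_pos_of_nontrivial v
  have hsum := T.sum_degrees_eq_twice_card_edges
  have hE := hT.card_edgeFinset
  simp only [hdeg]
  have e1 : ({v : V | T.degree v ≠ 2}).ncard = ∑ v, if T.degree v ≠ 2 then 1 else 0 := by
    rw [Set.ncard_eq_toFinset_card', ← Finset.card_filter, Set.toFinset_setOf]
  have e2 : ({v : V | T.degree v = 1}).ncard = ∑ v, if T.degree v = 1 then 1 else 0 := by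
    rw [Set.ncard_eq_toFinset_card', ← Finset.card_filter, Set.toFinset_setOf]
  have key : ∑ v : V, ((if T.degree v ≠ 2 then 1 else 0) + 2) ≤
      ∑ v : V, (2 * (if T.degree v = 1 then 1 else 0) + T.degree v) := by
    apply Finset.sum_le_sum
    intro v _
    have := hpos v
    split_ifs <;> omega
  rw [Finset.sum_add_distrib, Finset.sum_add_distrib, ← Finset.mul_sum, ← e1, ← e2, hsum] at key
  simp only [Finset.sum_const, Finset.card_univ, smul_eq_mul] at key
  omega


/-- **Lemma (Krivelevich).** For any integers `n, k > 2`, every tree on `n` vertices either has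
at least `n/(4k)` leaves or contains a collection of at least `n/(4k)` pairwise vertex-disjoint
bare paths each of length `k` (a bare path is a path all of whose internal vertices have degree
exactly two in the tree). -/
theorem tree_leaves_or_bare_paths
    (n k : ℕ) (hn : 2 < n) (hk : 2 < k)
    (V : Type*) [Fintype V] (hV : Fintype.card V = n)
    (T : SimpleGraph V) (hT : T.IsTree) :
    ((n : ℝ) / (4 * k) ≤ (({v : V | (T.neighborSet v).ncard = 1}).ncard : ℝ)) ∨
    ∃ (N : ℕ) (P : Fin N → Fin (k + 1) → V),
      (n : ℝ) / (4 * k) ≤ (N : ℝ) ∧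
      (∀ a, Function.Injective (P a)) ∧
      (∀ a, ∀ i : Fin k, T.Adj (P a i.castSucc) (P a i.succ)) ∧
      (∀ a, ∀ i : Fin (k + 1), 0 < (i : ℕ) → (i : ℕ) < k →
        (T.neighborSet (P a i)).ncard = 2) ∧
      (∀ a b, a ≠ b → ∀ i j, P a i ≠ P b j) := by
  classical
  by_cases hl : (n : ℝ) / (4 * k) ≤ (({v : V | (T.neighborSet v).ncard = 1}).ncard : ℝ)
  · exact Or.inl hl
  right
  have hcount := tlbp_count hT (by omega)
  set L := ({v : V | (T.neighborSet v).ncard = 1}).ncard with hL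
  obtain ⟨r⟩ := hT.connected.nonempty
  have hex : ∀ u, ∃ w, (T.neighborSet u).ncard = 2 → T.Adj u w ∧ T.dist r w = T.dist r u + 1 := by
    intro u
    by_cases hu : (T.neighborSet u).ncard = 2
    · obtain ⟨w, hw⟩ := tlbp_child hT r hu
      exact ⟨w, fun _ => hw⟩
    · exact ⟨u, fun h => absurd h hu⟩
  choose c hc using hex
  have hcinj : ∀ u u', (T.neighborSet u).ncard = 2 → (T.neighborSet u').ncard = 2 → c u = c u' →
      u = u' := by
    intro u u' hu hu' h
    have h1 := hc u hu
    have h2 := hc u' hu'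
    rw [← h] at h2
    exact tlbp_parent_unique hT r h1.1 h2.1 h1.2 h2.2
  have hit : ∀ i u u', (∀ j < i, (T.neighborSet (c^[j] u)).ncard = 2) →
      (∀ j < i, (T.neighborSet (c^[j] u')).ncard = 2) → c^[i] u = c^[i] u' → u = u' := by
    intro i
    induction i with
    | zero => intro u u' _ _ h; simpa using h
    | succ i ih =>
      intro u u' hu hu' h
      rw [Function.iterate_succ_apply', Function.iterate_succ_apply'] at h
      exact ih u u' (fun j hj => hu j (by omega)) (fun j hj => hu' j (by omega))
        (hcinj _ _ (hu i (by omega)) (hu' i (by omega)) h)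
  have hdist : ∀ i u, (∀ j < i, (T.neighborSet (c^[j] u)).ncard = 2) →
      T.dist r (c^[i] u) = T.dist r u + i := by
    intro i
    induction i with
    | zero => intro u _; simp
    | succ i ih =>
      intro u hu
      rw [Function.iterate_succ_apply', (hc _ (hu i (by omega))).2,
        ih u (fun j hj => hu j (by omega))]
      omega
  let good : V → Prop := fun u => ∀ i ≤ k, (T.neighborSet (c^[i] u)).ncard = 2
  let G : Finset V := Finset.univ.filter good
  let M : Finset V := Finset.univ.filter (fun v => (T.neighborSet v).ncard ≠ 2)
  have hM : ({v : V | (T.neighborSet v).ncard ≠ 2}).ncard = M.card := by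
    rw [Set.ncard_eq_toFinset_card']; simp [M]
  have hbad : (Finset.univ.filter (fun u => ¬ good u)).card ≤ (k + 1) * M.card := by
    have hmin : ∀ u, ∃ i, ¬ good u → i ≤ k ∧ (T.neighborSet (c^[i] u)).ncard ≠ 2 ∧
        ∀ j < i, (T.neighborSet (c^[j] u)).ncard = 2 := by
      intro u
      by_cases hu : good u
      · exact ⟨0, fun h => absurd hu h⟩
      · have hu' : ∃ i, i ≤ k ∧ (T.neighborSet (c^[i] u)).ncard ≠ 2 := by
          simpa only [good, not_forall, exists_prop] using hu
        refine ⟨Nat.find hu', fun _ => ⟨(Nat.find_spec hu').1, (Nat.find_spec hu').2, ?_⟩⟩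
        intro j hj
        have h1 := Nat.find_min hu' hj
        have h2 := (Nat.find_spec hu').1
        by_contra h3
        exact h1 ⟨by omega, h3⟩
    choose m hm using hmin
    have h := Finset.card_le_card_of_injOn (s := Finset.univ.filter (fun u => ¬ good u))
      (t := Finset.range (k + 1) ×ˢ M) (fun u => (m u, c^[m u] u)) ?_ ?_
    · simpa using h
    · intro u hu
      have hu' : ¬ good u := by simpa using hu
      have := hm u hu'
      simp only [Finset.coe_product, Set.mem_prod, Finset.mem_coe, Finset.mem_range, M,
        Finset.mem_filter, Finset.mem_univ, true_and]
      exact ⟨by omega, this.2.1⟩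
    · intro u hu v hv huv
      have hu' : ¬ good u := by simpa using hu
      have hv' : ¬ good v := by simpa using hv
      simp only [Prod.mk.injEq] at huv
      obtain ⟨h1, h2⟩ := huv
      have hv2 := (hm v hv').2.2
      rw [← h1] at h2 hv2
      exact hit _ u v (hm u hu').2.2 hv2 h2
  have hpart : G.card + (Finset.univ.filter (fun u => ¬ good u)).card = n := by
    rw [← hV]; exact Finset.card_filter_add_card_filter_not _
  have hk1 : (0 : ℝ) < (k : ℝ) + 1 := by positivity
  obtain ⟨y, -, hy⟩ := Finset.exists_le_card_fiber_of_nsmul_le_card_of_maps_to (s := G)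
    (t := Finset.range (k + 1)) (f := fun u => T.dist r u % (k + 1))
    (b := (G.card : ℝ) / ((k : ℝ) + 1))
    (fun u _ => Finset.mem_range.mpr (Nat.mod_lt _ (by omega))) ⟨0, by simp⟩
    (by simp only [Finset.card_range, nsmul_eq_mul]; push_cast; field_simp; rfl)
  set S := G.filter (fun u => T.dist r u % (k + 1) = y) with hS
  have hSg : ∀ a : S, good a := fun a => by
    have := a.2
    simp only [hS, G, Finset.mem_filter, Finset.mem_univ, true_and] at this
    exact this.1
  have hSy : ∀ a : S, T.dist r a % (k + 1) = y := fun a => by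
    have := a.2
    simp only [hS, G, Finset.mem_filter, Finset.mem_univ, true_and] at this
    exact this.2
  refine ⟨S.card, fun a i => c^[(i : ℕ)] (S.equivFin.symm a : V), ?_, ?_, ?_, ?_, ?_⟩
  · rw [div_le_iff₀ hk1] at hy
    rw [not_le, lt_div_iff₀ (by positivity)] at hl
    rw [div_le_iff₀ (by positivity)]
    have h1 : n ≤ G.card + (k + 1) * M.card := by omega
    have h2 : M.card + 2 ≤ 2 * L := by omega
    have h1' : (n : ℝ) ≤ G.card + (k + 1) * M.card := by exact_mod_cast h1
    have h2' : (M.card : ℝ) + 2 ≤ 2 * L := by exact_mod_cast h2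
    have hk3 : (3 : ℝ) ≤ k := by exact_mod_cast hk
    have hn0 : (0 : ℝ) ≤ n := by positivity
    have h3 : (n : ℝ) ≤ S.card * (k + 1) + (k + 1) * (2 * L) := by
      have : ((k : ℝ) + 1) * M.card ≤ (k + 1) * (2 * L) :=
        mul_le_mul_of_nonneg_left (by linarith) hk1.le
      linarith
    have h4 : 4 * (k : ℝ) * n ≤ 4 * k * (S.card * (k + 1) + (k + 1) * (2 * L)) :=
      mul_le_mul_of_nonneg_left h3 (by positivity)
    have h5 : 2 * ((k : ℝ) + 1) * (L * (4 * k)) ≤ 2 * (k + 1) * n :=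
      mul_le_mul_of_nonneg_left hl.le (by positivity)
    have h6 : ((k : ℝ) - 3) * n ≥ 0 := mul_nonneg (by linarith) hn0
    have h7 : ((k : ℝ) + 1) * n ≤ (k + 1) * (S.card * (4 * k)) := by nlinarith
    exact le_of_mul_le_mul_left h7 hk1
  · intro a i j hij
    have hg := hSg (S.equivFin.symm a)
    have h1 := hdist i _ (fun l hl => hg l (by omega))
    have h2 := hdist j _ (fun l hl => hg l (by omega))
    have h3 := congrArg (T.dist r) hij
    ext
    simp only at h3
    omega
  · intro a i
    have hg := hSg (S.equivFin.symm a)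
    simp only [Fin.val_castSucc, Fin.val_succ]
    rw [Function.iterate_succ_apply']
    exact (hc _ (hg i (by omega))).1
  · intro a i _ _
    exact hSg (S.equivFin.symm a) i (by omega)
  · intro a b hab i j hij
    have hg := hSg (S.equivFin.symm a)
    have hg' := hSg (S.equivFin.symm b)
    have h1 := hdist i _ (fun l hl => hg l (by omega))
    have h2 := hdist j _ (fun l hl => hg' l (by omega))
    have h3 := congrArg (T.dist r) hij
    simp only at h3
    have hmod : T.dist r (S.equivFin.symm a : V) + i ≡ T.dist r (S.equivFin.symm b : V) + j
        [MOD (k + 1)] := by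
      have h4 : T.dist r (S.equivFin.symm a : V) + i = T.dist r (S.equivFin.symm b : V) + j := by
        omega
      rw [h4]
    have hmod2 : T.dist r (S.equivFin.symm a : V) ≡ T.dist r (S.equivFin.symm b : V)
        [MOD (k + 1)] := (hSy _).trans (hSy _).symm
    have hij' : (i : ℕ) = j :=
      Nat.ModEq.eq_of_lt_of_lt (Nat.ModEq.add_left_cancel hmod2 hmod) i.2 j.2
    have hij2 : c^[(i : ℕ)] (S.equivFin.symm a : V) = c^[(i : ℕ)] (S.equivFin.symm b : V) := by
      have h5 : c^[(i : ℕ)] (S.equivFin.symm a : V) = c^[(j : ℕ)] (S.equivFin.symm b : V) := hij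
      rw [h5, hij']
    have := hit i _ _ (fun l hl => hg l (by omega)) (fun l hl => hg' l (by omega)) hij2
    exact hab (S.equivFin.symm.injective (Subtype.ext this))
end

section
/- Let n, Δ be positive integers and d a positive real with d ≥ 2Δ, and let G be an (n,d)-expander. Then G contains a copy of every tree on n − 4Δ⌈n/(2d)⌉ vertices with maximum degree at most Δ. -/
open Classical in
/-- The (not necessarily external) joint neighbourhood of a finite set. -/
noncomputable def gam {V : Type*} [Fintype V] (G : SimpleGraph V) (U : Finset V) : Finset V :=
  Finset.univ.filter (fun v => ∃ u ∈ U, G.Adj u v)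

theorem mem_gam {V : Type*} [Fintype V] (G : SimpleGraph V) (U : Finset V) (v : V) :
    v ∈ gam G U ↔ ∃ u ∈ U, G.Adj u v := by
  simp [gam]

open Classical in
/-- Adding one leaf at `s` (Friedman–Pippenger / Haxell step). -/
theorem ext_step {V : Type*} [Fintype V] (G : SimpleGraph V) (S : Finset V)
    (ρ : V → ℕ) (s : V) (m : ℕ) (hm : 1 ≤ m) (hs : 1 ≤ ρ s)
    (h1 : ∀ U : Finset V, U.card ≤ 2 * m → ∑ x ∈ U, ρ x ≤ (gam G U \ S).card)
    (h2 : ∀ U : Finset V, m ≤ U.card → U.card ≤ 2 * m → ∑ x ∈ U, ρ x < (gam G U \ S).card) :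
    ∃ y, y ∉ S ∧ G.Adj s y ∧ ∀ U : Finset V, U.card ≤ 2 * m →
      ∑ x ∈ U, Function.update ρ s (ρ s - 1) x ≤ (gam G U \ insert y S).card := by
  by_contra hcon
  push Not at hcon
  have key : ∀ y, y ∉ S → G.Adj s y → ∃ U : Finset V, U.card < m ∧
      (gam G U \ S).card = ∑ x ∈ U, ρ x ∧ s ∉ U ∧ y ∈ gam G U := by
    intro y hy hsy
    obtain ⟨U, hU, hlt⟩ := hcon y hy hsy
    have hle : ∑ x ∈ U, Function.update ρ s (ρ s - 1) x ≤ ∑ x ∈ U, ρ x := by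
      apply Finset.sum_le_sum
      intro x _
      by_cases hx : x = s
      · subst hx; simp
      · simp [hx]
    have h1U := h1 U hU
    have hc : gam G U \ insert y S = (gam G U \ S).erase y := by
      ext z; simp only [Finset.mem_sdiff, Finset.mem_insert, Finset.mem_erase]; tauto
    have hc1 : (gam G U \ S).card - 1 ≤ (gam G U \ insert y S).card := by
      rw [hc]; exact Finset.pred_card_le_card_erase
    have htight : (gam G U \ S).card = ∑ x ∈ U, ρ x := by omega
    refine ⟨U, ?_, htight, ?_, ?_⟩
    · by_contra hmU
      have := h2 U (by omega) hU
      omega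
    · intro hsU
      have e1 := Finset.sum_update_of_mem hsU ρ (ρ s - 1)
      have e2 := Finset.sum_erase_add U ρ hsU
      rw [Finset.sdiff_singleton_eq_erase] at e1
      omega
    · by_contra hyU
      have : (gam G U \ S).erase y = gam G U \ S := by
        apply Finset.erase_eq_of_notMem
        simp [hyU]
      rw [hc, this] at hlt
      omega
  have union : ∀ A : Finset V, (∀ y ∈ A, y ∉ S ∧ G.Adj s y) → ∃ U : Finset V, U.card < m ∧
      (gam G U \ S).card = ∑ x ∈ U, ρ x ∧ s ∉ U ∧ A ⊆ gam G U := by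
    intro A
    induction A using Finset.induction_on with
    | empty =>
      intro _
      refine ⟨∅, by rw [Finset.card_empty]; omega, ?_, by simp, by simp⟩
      simp [gam]
    | insert a A ha ih =>
      intro h
      obtain ⟨U, hU, hUt, hsU, hAU⟩ := ih (fun y hy => h y (Finset.mem_insert_of_mem hy))
      obtain ⟨hay, has⟩ := h a (Finset.mem_insert_self _ _)
      obtain ⟨U', hU', hUt', hsU', haU'⟩ := key a hay has
      have hcu : (U ∪ U').card + (U ∩ U').card = U.card + U'.card :=
        Finset.card_union_add_card_inter U U'
      have hsu : ∑ x ∈ U ∪ U', ρ x + ∑ x ∈ U ∩ U', ρ x = ∑ x ∈ U, ρ x + ∑ x ∈ U', ρ x :=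
        Finset.sum_union_inter
      have hgu : gam G (U ∪ U') \ S = (gam G U \ S) ∪ (gam G U' \ S) := by
        ext z
        simp only [Finset.mem_sdiff, Finset.mem_union, mem_gam]
        constructor
        · rintro ⟨⟨u, hu | hu, h⟩, hz⟩
          · exact Or.inl ⟨⟨u, hu, h⟩, hz⟩
          · exact Or.inr ⟨⟨u, hu, h⟩, hz⟩
        · rintro (⟨⟨u, hu, h⟩, hz⟩ | ⟨⟨u, hu, h⟩, hz⟩)
          · exact ⟨⟨u, Or.inl hu, h⟩, hz⟩
          · exact ⟨⟨u, Or.inr hu, h⟩, hz⟩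
      have hgi : (gam G (U ∩ U') \ S) ⊆ (gam G U \ S) ∩ (gam G U' \ S) := by
        intro z
        simp only [Finset.mem_sdiff, Finset.mem_inter, mem_gam]
        rintro ⟨⟨u, hu, h⟩, hz⟩
        exact ⟨⟨⟨u, hu.1, h⟩, hz⟩, ⟨u, hu.2, h⟩, hz⟩
      have hgi' := Finset.card_le_card hgi
      have hgc := Finset.card_union_add_card_inter (gam G U \ S) (gam G U' \ S)
      rw [← hgu] at hgc
      have i1 := h1 (U ∪ U') (by omega)
      have i2 := h1 (U ∩ U') (by omega)
      have ht : (gam G (U ∪ U') \ S).card = ∑ x ∈ U ∪ U', ρ x := by omega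
      refine ⟨U ∪ U', ?_, ht, by simp [hsU, hsU'], ?_⟩
      · by_contra hmU
        have := h2 (U ∪ U') (by omega) (by omega)
        omega
      · intro z hz
        rw [mem_gam]
        rcases Finset.mem_insert.1 hz with rfl | hz
        · obtain ⟨u, hu, h⟩ := (mem_gam _ _ _).1 haU'
          exact ⟨u, Finset.mem_union_right _ hu, h⟩
        · obtain ⟨u, hu, h⟩ := (mem_gam _ _ _).1 (hAU hz)
          exact ⟨u, Finset.mem_union_left _ hu, h⟩
  obtain ⟨U, hU, hUt, hsU, hAU⟩ := union (gam G {s} \ S) (by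
    intro y hy
    simp only [Finset.mem_sdiff, mem_gam, Finset.mem_singleton, exists_eq_left] at hy
    exact ⟨hy.2, hy.1⟩)
  have hfin := h1 (insert s U) (by rw [Finset.card_insert_of_notMem hsU]; omega)
  rw [Finset.sum_insert hsU] at hfin
  have : gam G (insert s U) \ S ⊆ gam G U \ S := by
    intro z hz
    simp only [Finset.mem_sdiff, mem_gam] at hz ⊢
    obtain ⟨⟨u, hu, h⟩, hzS⟩ := hz
    refine ⟨?_, hzS⟩
    rcases Finset.mem_insert.1 hu with rfl | hu
    · refine (mem_gam _ _ _).1 (hAU ?_)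
      simp [mem_gam, h, hzS]
    · exact ⟨u, hu, h⟩
  have := Finset.card_le_card this
  omega

open Classical in
/-- Embedding trees one leaf at a time, keeping the extendability invariant. -/
theorem embed_aux {V : Type*} [Fintype V] (G : SimpleGraph V) (m Δ N : ℕ) (hm : 1 ≤ m) [Nonempty V]
    (h0 : ∀ v : V, ∀ U : Finset V, U.card ≤ 2 * m → Δ * U.card ≤ (gam G U \ {v}).card)
    (h2 : ∀ S U : Finset V, S.card ≤ N → m ≤ U.card → U.card ≤ 2 * m →
      Δ * U.card < (gam G U \ S).card)
    (k : ℕ) : ∀ (W : Type*) [Fintype W] (T : SimpleGraph W), Fintype.card W = k + 1 → k + 1 ≤ N →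
      T.IsTree → (∀ w, (T.neighborSet w).ncard ≤ Δ) →
      ∃ (f : W → V) (ρ : V → ℕ), Function.Injective f ∧ (∀ u v, T.Adj u v → G.Adj (f u) (f v)) ∧
        (∀ x, ρ x ≤ Δ) ∧ (∀ x, (∀ w, f w ≠ x) → ρ x = Δ) ∧
        (∀ p, Δ ≤ ρ (f p) + (T.neighborSet p).ncard) ∧
        ∀ U : Finset V, U.card ≤ 2 * m →
          ∑ x ∈ U, ρ x ≤ (gam G U \ Finset.univ.image f).card := by
  induction k with
  | zero =>
    intro W _ T hW hN hT hΔ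
    have hsub : Subsingleton W := Fintype.card_le_one_iff_subsingleton.1 (by omega)
    obtain ⟨v⟩ := ‹Nonempty V›
    have hne : Nonempty W := Fintype.card_pos_iff.1 (by omega)
    refine ⟨fun _ => v, fun _ => Δ, Function.injective_of_subsingleton _, ?_, by simp, by simp,
      by simp, ?_⟩
    · intro a b hab
      exact absurd (Subsingleton.elim a b) hab.ne
    · intro U hU
      have : Finset.univ.image (fun _ : W => v) = {v} :=
        Finset.image_const Finset.univ_nonempty v
      rw [this]
      have := h0 v U hU
      simpa [mul_comm] using this
  | succ k ih =>
    intro W _ T hW hN hT hΔ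
    have hnt : Nontrivial W := Fintype.one_lt_card_iff_nontrivial.1 (by omega)
    obtain ⟨l, hl⟩ := hT.exists_vert_degree_one_of_nontrivial
    have hc : (T.induce ({l}ᶜ : Set W)).IsTree :=
      ⟨hT.1.induce_compl_singleton_of_degree_eq_one hl, hT.2.induce _⟩
    have hcard : Fintype.card ({l}ᶜ : Set W) = k + 1 := by
      rw [Fintype.card_compl_set]; simp; omega
    obtain ⟨p, hp, hpu⟩ := SimpleGraph.degree_eq_one_iff_existsUnique_adj.1 hl
    have hpl : p ≠ l := hp.ne'
    have hnb : ∀ w : ({l}ᶜ : Set W), ((T.induce ({l}ᶜ : Set W)).neighborSet w).ncard =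
        (T.neighborSet (w : W) \ {l}).ncard := by
      intro w
      rw [← Set.ncard_image_of_injective _ Subtype.val_injective]
      congr 1
      ext z
      simp [and_comm]
    have hnb' : ∀ w : ({l}ᶜ : Set W), ((T.induce ({l}ᶜ : Set W)).neighborSet w).ncard ≤
        (T.neighborSet (w : W)).ncard := by
      intro w
      rw [hnb]; exact Set.ncard_le_ncard Set.sdiff_subset
    obtain ⟨f, ρ, hf, hadj, hρ, hρ', hρf, hU⟩ := ih _ (T.induce ({l}ᶜ : Set W)) hcard (by omega) hc
      (fun w => (hnb' w).trans (hΔ _))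
    have hnp : ((T.induce ({l}ᶜ : Set W)).neighborSet ⟨p, hpl⟩).ncard + 1 =
        (T.neighborSet p).ncard := by
      rw [hnb]
      exact Set.ncard_sdiff_singleton_add_one (by simpa using hp.symm)
    have hS : (Finset.univ.image f).card ≤ N := by
      rw [Finset.card_image_of_injective _ hf, Finset.card_univ, hcard]; omega
    have hρp := hρf ⟨p, hpl⟩
    have hΔp := hΔ p
    obtain ⟨y, hyS, hsy, hyU⟩ := ext_step G (Finset.univ.image f) ρ (f ⟨p, hpl⟩) m hm (by omega) hU
      (fun U hm1 hm2 => lt_of_le_of_lt (by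
        calc ∑ x ∈ U, ρ x ≤ ∑ x ∈ U, Δ := Finset.sum_le_sum (fun x _ => hρ x)
          _ = Δ * U.card := by simp [mul_comm]) (h2 _ U hS hm1 hm2))
    have hy : ∀ w, f w ≠ y := by simpa using hyS
    let g : W → V := fun w => if h : w = l then y else f ⟨w, h⟩
    have gl : g l = y := by simp [g]
    have gw : ∀ w (h : w ≠ l), g w = f ⟨w, h⟩ := by intro w h; simp [g, h]
    have hyp : y ≠ f ⟨p, hpl⟩ := (hy _).symm
    refine ⟨g, Function.update ρ (f ⟨p, hpl⟩) (ρ (f ⟨p, hpl⟩) - 1), ?_, ?_, ?_, ?_, ?_, ?_⟩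
    · intro a b hab
      by_cases ha : a = l <;> by_cases hb : b = l
      · rw [ha, hb]
      · rw [ha, gl, gw b hb] at hab; exact absurd hab.symm (hy _)
      · rw [hb, gl, gw a ha] at hab; exact absurd hab (hy _)
      · rw [gw a ha, gw b hb] at hab
        exact congrArg Subtype.val (hf hab)
    · intro a b hab
      by_cases ha : a = l <;> by_cases hb : b = l
      · subst ha; subst hb; exact absurd rfl hab.ne
      · subst ha
        have := hpu b hab
        subst this
        rw [gl, gw b hb]; exact hsy.symm
      · subst hb
        have := hpu a hab.symm
        subst this
        rw [gl, gw a ha]; exact hsy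
      · rw [gw a ha, gw b hb]
        exact hadj _ _ (by simpa using hab)
    · intro x
      by_cases hx : x = f ⟨p, hpl⟩
      · subst hx; simp; have := hρ (f ⟨p, hpl⟩); omega
      · simp [hx, hρ]
    · intro x hx
      have : x ≠ f ⟨p, hpl⟩ := by
        intro h; exact hx p (by rw [gw p hpl, h])
      rw [Function.update_of_ne this]
      apply hρ'
      intro w hw
      exact hx w (by rw [gw w w.2, ← hw])
    · intro q
      by_cases hq : q = l
      · subst hq
        rw [gl, Function.update_of_ne hyp, hρ' y hy]; omega
      · rw [gw q hq]
        by_cases hqp : q = p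
        · subst hqp
          rw [Function.update_self]; omega
        · have : f ⟨q, hq⟩ ≠ f ⟨p, hpl⟩ := by
            intro h; exact hqp (congrArg Subtype.val (hf h))
          rw [Function.update_of_ne this]
          have := hρf ⟨q, hq⟩
          have := hnb' ⟨q, hq⟩
          simp only at this
          omega
    · intro U hUc
      have : Finset.univ.image g = insert y (Finset.univ.image f) := by
        ext z
        simp only [Finset.mem_image, Finset.mem_univ, true_and, Finset.mem_insert]
        constructor
        · rintro ⟨w, rfl⟩
          by_cases hw : w = l
          · left; rw [hw, gl]
          · right; exact ⟨⟨w, hw⟩, (gw w hw).symm⟩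
        · rintro (rfl | ⟨w, rfl⟩)
          · exact ⟨l, gl⟩
          · exact ⟨w, gw w w.2⟩
      rw [this]
      exact hyU U hUc

/-- **Theorem (Johannsen–Krivelevich–Samotij).** Let `n, Δ` be positive integers, `d ≥ 2Δ` a
positive real, and let `G` be an `(n,d)`-expander, i.e., an `n`-vertex graph such that
(1) `|N_G(X)| ≥ d|X|` for every `X` with `1 ≤ |X| < ⌈n/(2d)⌉`, and
(2) there is an edge between any two disjoint sets of size `⌈n/(2d)⌉`.
Then `G` contains a copy of every tree on `n − 4Δ⌈n/(2d)⌉` vertices with maximum degree at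
most `Δ`. -/
theorem expander_contains_almost_spanning_trees
    (n Δ : ℕ) (hn : 0 < n) (hΔ : 0 < Δ) (d : ℝ) (hd : 0 < d) (hdΔ : 2 * Δ ≤ d)
    (V : Type*) [Fintype V] (hV : Fintype.card V = n)
    (G : SimpleGraph V)
    (hexp1 : ∀ X : Set V, 1 ≤ X.ncard → X.ncard < ⌈(n : ℝ) / (2 * d)⌉₊ →
      d * X.ncard ≤ (({v : V | v ∉ X ∧ ∃ u ∈ X, G.Adj u v}).ncard : ℝ))
    (hexp2 : ∀ X Y : Set V, Disjoint X Y → X.ncard = ⌈(n : ℝ) / (2 * d)⌉₊ →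
      Y.ncard = ⌈(n : ℝ) / (2 * d)⌉₊ → ∃ x ∈ X, ∃ y ∈ Y, G.Adj x y)
    (W : Type*) [Fintype W] (hW : Fintype.card W = n - 4 * Δ * ⌈(n : ℝ) / (2 * d)⌉₊)
    (T : SimpleGraph W) (hT : T.IsTree)
    (hΔT : ∀ w, (T.neighborSet w).ncard ≤ Δ) :
    ∃ f : W → V, Function.Injective f ∧ ∀ u v, T.Adj u v → G.Adj (f u) (f v) := by
  classical
  set m := ⌈(n : ℝ) / (2 * d)⌉₊ with hmdef
  have hm : 1 ≤ m := by
    rw [hmdef, Nat.one_le_ceil_iff]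
    positivity
  have hne : Nonempty W := hT.1.nonempty
  have hWpos : 0 < Fintype.card W := Fintype.card_pos
  have hnV : Nonempty V := Fintype.card_pos_iff.1 (by omega)
  have hΔm : m ≤ Δ * m := Nat.le_mul_of_pos_left m hΔ
  have h4 : 4 * Δ * m = 4 * (Δ * m) := by ring
  rw [h4] at hW
  -- large sets have a large neighbourhood
  have hbig : ∀ U : Finset V, m ≤ U.card → n + 1 ≤ (gam G U).card + 2 * m := by
    intro U hU
    by_contra hcon
    obtain ⟨X, hXU, hX⟩ := Finset.exists_subset_card_eq hU
    have hcompl : ((gam G U)ᶜ).card = n - (gam G U).card := by rw [Finset.card_compl, hV]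
    have hd1 := Finset.le_card_sdiff X ((gam G U)ᶜ)
    obtain ⟨Y, hY, hYc⟩ := Finset.exists_subset_card_eq (s := (gam G U)ᶜ \ X) (n := m) (by omega)
    obtain ⟨x, hx, y, hy, hxy⟩ := hexp2 (X : Set V) (Y : Set V) (by
      rw [Finset.disjoint_coe, Finset.disjoint_left]
      intro a ha haY
      exact (Finset.mem_sdiff.1 (hY haY)).2 ha) (by simpa using hX) (by simpa using hYc)
    have := (Finset.mem_sdiff.1 (hY hy)).1
    rw [Finset.mem_compl, mem_gam] at this
    exact this ⟨x, hXU hx, hxy⟩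
  have h2 : ∀ S U : Finset V, S.card ≤ n - 4 * (Δ * m) → m ≤ U.card → U.card ≤ 2 * m →
      Δ * U.card < (gam G U \ S).card := by
    intro S U hS hU hU2
    have a1 := hbig U hU
    have a2 := Finset.le_card_sdiff S (gam G U)
    have a3 : Δ * U.card ≤ Δ * (2 * m) := Nat.mul_le_mul_left _ hU2
    have a4 : Δ * (2 * m) = 2 * (Δ * m) := by ring
    omega
  have h0 : ∀ v : V, ∀ U : Finset V, U.card ≤ 2 * m → Δ * U.card ≤ (gam G U \ {v}).card := by
    intro v U hU
    by_cases hUm : m ≤ U.card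
    · exact (h2 {v} U (by rw [Finset.card_singleton]; omega) hUm hU).le
    · by_cases hU0 : U.card = 0
      · simp [hU0]
      · have e := hexp1 (U : Set V) (by rw [Set.ncard_coe_finset]; omega)
          (by rw [Set.ncard_coe_finset]; omega)
        have e1 : ({v : V | v ∉ (U : Set V) ∧ ∃ u ∈ (U : Set V), G.Adj u v}).ncard
            ≤ (gam G U).card := by
          rw [← Set.ncard_coe_finset (gam G U)]
          refine Set.ncard_le_ncard ?_ (Set.toFinite _)
          intro z hz
          simpa [mem_gam] using hz.2
        rw [Set.ncard_coe_finset] at e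
        have e2 : (2 * Δ * U.card : ℝ) ≤ (gam G U).card := by
          calc (2 * Δ * U.card : ℝ) ≤ d * U.card := by gcongr
            _ ≤ _ := e
            _ ≤ _ := by exact_mod_cast e1
        have e3 : 2 * Δ * U.card ≤ (gam G U).card := by exact_mod_cast e2
        have e4 : 2 * Δ * U.card = 2 * (Δ * U.card) := by ring
        have e5 : 0 < Δ * U.card := Nat.mul_pos hΔ (by omega)
        have a2 := Finset.le_card_sdiff {v} (gam G U)
        rw [Finset.card_singleton] at a2
        omega
  obtain ⟨f, _, hf, hadj, _⟩ := embed_aux G m Δ (n - 4 * (Δ * m)) hm h0 h2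
    (Fintype.card W - 1) W T (by omega) (by omega) hT hΔT
  exact ⟨f, hf, hadj⟩
end

section
/- Let d, m be positive integers and let G be a graph. Suppose two disjoint sets U, W ⊆ V(G) satisfy: (1) |N_G(X) ∩ W| ≥ d|X| for all sets X ⊆ U with 1 ≤ |X| ≤ m; (2) e_G(X,Y) > 0 for all X ⊆ U and Y ⊆ W with |X| = |Y| ≥ m; and (3) every w ∈ W has at least m neighbors in U. Then for every function f : U → {1, …, d} with Σ_{u∈U} f(u) = |W|, there exists an f-matching from U into W. -/
/-- **Lemma (Johannsen–Krivelevich–Samotij, star-matching lemma).** Let `d, m` be positive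
integers and `G` a graph with disjoint vertex sets `U, W` satisfying:
(1) `|N_G(X) ∩ W| ≥ d|X|` for all `X ⊆ U` with `1 ≤ |X| ≤ m`;
(2) there is an edge between any `X ⊆ U` and `Y ⊆ W` with `|X| = |Y| ≥ m`;
(3) every `w ∈ W` has at least `m` neighbors in `U`.
Then for every `f : U → {1,…,d}` with `∑_{u∈U} f(u) = |W|` there is an `f`-matching from `U`
into `W`, encoded by a map `g` assigning to each `w ∈ W` the center `g w ∈ U` of its star,
with each `u ∈ U` receiving exactly `f u` leaves. -/
theorem star_matching_lemma
    (V : Type*) [Fintype V] [DecidableEq V] (G : SimpleGraph V)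
    (d m : ℕ) (hd : 0 < d) (hm : 0 < m)
    (U W : Finset V) (hUW : Disjoint U W)
    (h1 : ∀ X ⊆ U, 1 ≤ X.card → X.card ≤ m →
      (d * X.card : ℝ) ≤ (({v : V | v ∉ (X : Set V) ∧ ∃ u ∈ X, G.Adj u v} ∩ ↑W).ncard : ℝ))
    (h2 : ∀ X ⊆ U, ∀ Y ⊆ W, X.card = Y.card → m ≤ X.card →
      ∃ x ∈ X, ∃ y ∈ Y, G.Adj x y)
    (h3 : ∀ w ∈ W, m ≤ (G.neighborSet w ∩ ↑U).ncard)
    (f : V → ℕ) (hf1 : ∀ u ∈ U, 1 ≤ f u ∧ f u ≤ d)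
    (hf2 : ∑ u ∈ U, f u = W.card) :
    ∃ g : V → V, (∀ w ∈ W, g w ∈ U ∧ G.Adj (g w) w) ∧
      ∀ u ∈ U, ({w : V | w ∈ W ∧ g w = u}).ncard = f u := by
  classical
  have key : ∀ Y ⊆ W, Y.card ≤ ∑ u ∈ U.filter (fun u => ∃ w ∈ Y, G.Adj u w), f u := by
    intro Y hY
    rcases Y.eq_empty_or_nonempty with rfl | ⟨w, hw⟩
    · simp
    by_contra! hlt
    set A := U.filter (fun u => ∃ w ∈ Y, G.Adj u w) with hA
    set X := U.filter (fun u => ¬ ∃ w ∈ Y, G.Adj u w) with hX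
    have hAU : A ⊆ U := Finset.filter_subset _ _
    have hXU : X ⊆ U := Finset.filter_subset _ _
    have hnbr : m ≤ A.card := by
      refine (h3 w (hY hw)).trans ?_
      rw [← Set.ncard_coe_finset]
      apply Set.ncard_le_ncard _ (Finset.finite_toSet _)
      rintro u ⟨hu, huU⟩
      simp only [hA, Finset.coe_filter, Set.mem_ofPred_eq]
      exact ⟨huU, w, hw, G.adj_symm hu⟩
    have hcA : A.card ≤ ∑ u ∈ A, f u := by
      rw [Finset.card_eq_sum_ones]
      exact Finset.sum_le_sum fun u hu => (hf1 u (hAU hu)).1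
    have hsum : ∑ u ∈ A, f u + ∑ u ∈ X, f u = W.card := by
      rw [← hf2]
      exact Finset.sum_filter_add_sum_filter_not U _ f
    have hfX : ∑ u ∈ X, f u ≤ d * X.card := by
      rw [mul_comm]
      exact Finset.sum_le_card_nsmul _ _ _ fun u hu => (hf1 u (hXU hu)).2
    have hno : ∀ x ∈ X, ∀ y ∈ Y, ¬ G.Adj x y := by
      intro x hx y hy h
      exact (Finset.mem_filter.1 hx).2 ⟨y, hy, h⟩
    have hXm : X.card < m := by
      by_contra! hge
      obtain ⟨X', hX', hcX⟩ := Finset.exists_subset_card_eq hge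
      obtain ⟨Y', hY', hcY⟩ := Finset.exists_subset_card_eq (show m ≤ Y.card by omega)
      obtain ⟨x, hx, y, hy, h⟩ := h2 X' (hX'.trans hXU) Y' (hY'.trans hY) (by omega) (by omega)
      exact hno x (hX' hx) y (hY' hy) h
    have hYW := Finset.card_le_card hY
    rcases Nat.eq_zero_or_pos X.card with h0 | h0
    · rw [h0] at hfX
      omega
    have h := h1 X hXU h0 hXm.le
    have h' : d * X.card ≤ (W \ Y).card := by
      have h4 : d * X.card ≤ ({v : V | v ∉ (X : Set V) ∧ ∃ u ∈ X, G.Adj u v} ∩ ↑W).ncard := by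
        exact_mod_cast h
      refine h4.trans ?_
      rw [← Set.ncard_coe_finset]
      apply Set.ncard_le_ncard _ (Finset.finite_toSet _)
      rintro v ⟨⟨-, u, hu, huv⟩, hvW⟩
      simp only [Finset.coe_sdiff, Set.mem_sdiff, Finset.mem_coe]
      exact ⟨hvW, fun hv => hno u hu v hv huv⟩
    rw [Finset.card_sdiff_of_subset hY] at h'
    omega
  let t : W → Finset (Σ _ : V, ℕ) := fun w =>
    (U.filter (fun u => G.Adj u w)).sigma (fun u => Finset.range (f u))
  obtain ⟨F, hFi, hF⟩ := (Finset.all_card_le_biUnion_card_iff_exists_injective t).1 (by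
    intro s
    have h := key (s.map (Function.Embedding.subtype _)) (by
      intro x hx
      obtain ⟨y, -, rfl⟩ := Finset.mem_map.1 hx
      exact y.2)
    rw [Finset.card_map] at h
    refine h.trans ?_
    have e : ∀ B : Finset V, ∑ u ∈ B, f u = (B.sigma (fun u => Finset.range (f u))).card := by
      intro B
      simp [Finset.card_sigma]
    rw [e]
    apply Finset.card_le_card
    rintro ⟨u, i⟩ hu
    simp only [Finset.mem_sigma, Finset.mem_filter, Finset.mem_map] at hu
    obtain ⟨⟨huU, w, ⟨y, hy, rfl⟩, hadj⟩, hi⟩ := hu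
    simp only [t, Finset.mem_biUnion, Finset.mem_sigma, Finset.mem_filter]
    exact ⟨y, hy, ⟨huU, hadj⟩, hi⟩)
  have hF' : ∀ w, (F w).1 ∈ U ∧ G.Adj (F w).1 w ∧ (F w).2 < f (F w).1 := by
    intro w
    have := hF w
    simp only [t, Finset.mem_sigma, Finset.mem_filter, Finset.mem_range] at this
    exact ⟨this.1.1, this.1.2, this.2⟩
  let g : V → V := fun v => if h : v ∈ W then (F ⟨v, h⟩).1 else v
  have hg : ∀ v (h : v ∈ W), g v = (F ⟨v, h⟩).1 := fun v h => dif_pos h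
  have hgU : ∀ w ∈ W, g w ∈ U := fun w hw => by rw [hg w hw]; exact (hF' _).1
  refine ⟨g, fun w hw => ⟨hgU w hw, by rw [hg w hw]; exact (hF' ⟨w, hw⟩).2.1⟩, ?_⟩
  have hle : ∀ u ∈ U, (W.filter (fun w => g w = u)).card ≤ f u := by
    intro u hu
    rw [← Finset.card_range (f u)]
    apply Finset.card_le_card_of_injOn (fun v => if h : v ∈ W then (F ⟨v, h⟩).2 else 0)
    · intro v hv
      obtain ⟨hv, hgv⟩ := Finset.mem_filter.1 hv
      simp only [dif_pos hv, Finset.coe_range, Set.mem_Iio]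
      rw [← hgv, hg v hv]
      exact (hF' _).2.2
    · intro v hv v' hv' hvv
      obtain ⟨hv, hgv⟩ := Finset.mem_filter.1 hv
      obtain ⟨hv', hgv'⟩ := Finset.mem_filter.1 hv'
      simp only [dif_pos hv, dif_pos hv'] at hvv
      have : F ⟨v, hv⟩ = F ⟨v', hv'⟩ := by
        apply Sigma.ext
        · rw [← hg v hv, ← hg v' hv', hgv, hgv']
        · exact heq_of_eq hvv
      exact congrArg Subtype.val (hFi this)
  have hs : ∑ u ∈ U, (W.filter (fun w => g w = u)).card = ∑ u ∈ U, f u := by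
    rw [hf2]
    exact (Finset.card_eq_sum_card_fiberwise hgU).symm
  intro u hu
  rw [← (Finset.sum_eq_sum_iff_of_le hle).1 hs u hu, ← Set.ncard_coe_finset]
  congr 1
  ext w
  simp
end
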